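/- The number of integers c in the range [-x, x] that can be written in the form c = F_n - 2^m for some natural numbers n, m is asymptotically equal to (log x)² / (log((1+√5)/2) · log 2) as x → ∞; that is, the ratio of Nat.card {c : ℤ | |c| ≤ x ∧ ∃ n m, (c : ℤ) = F n - 2^m} to (log x)² / (log((1+√5)/2) · log 2) tends to 1 as the real number x tends to infinity. -/

import Mathlib

open Filter

/-- Iterated Rolle theorem: if `f 0` has `n + 1` zeros, then its `n`-th derivative `f n` vanishes
somewhere between them. -/
theorem exists_zero_of_strictMono_zeros {f : ℕ → ℝ → ℝ}
    (hf : ∀ k t, HasDerivAt (f k) (f (k + 1) t) t) (n : ℕ) (lo hi : ℝ) (x : Fin (n + 1) → ℝ)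
    (hx : StrictMono x) (hmem : ∀ i, x i ∈ Set.Icc lo hi) (hzero : ∀ i, f 0 (x i) = 0) :
    ∃ ξ ∈ Set.Icc lo hi, f n ξ = 0 := by
  induction n generalizing f with
  | zero => exact ⟨x 0, hmem 0, hzero 0⟩
  | succ n ih =>
    have key : ∀ i : Fin (n + 1), ∃ y ∈ Set.Ioo (x i.castSucc) (x i.succ), f 1 y = 0 := fun i =>
      exists_hasDerivAt_eq_zero (hx i.castSucc_lt_succ)
        (fun t _ => (hf 0 t).continuousAt.continuousWithinAt) (by rw [hzero, hzero])
        (fun t _ => hf 0 t)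
    choose y hy hy0 using key
    refine ih (f := fun k => f (k + 1)) (fun k t => hf (k + 1) t) y ?_ ?_ hy0
    · intro i j hij
      calc y i < x i.succ := (hy i).2
        _ ≤ x j.castSucc := hx.monotone (by
            rw [Fin.le_def, Fin.val_succ, Fin.val_castSucc]; exact hij)
        _ < y j := (hy j).1
    · exact fun i => ⟨(hmem _).1.trans (hy i).1.le, (hy i).2.le.trans (hmem _).2⟩

/-- The divided difference of `t ↦ u ^ t` at the nodes `v i`. -/
theorem exists_sum_rpow_div_prod_eq {ι : Type*} [DecidableEq ι] (s : Finset ι) (v : ι → ℝ)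
    (hv : Set.InjOn v s) (K : ℕ) (hs : s.card = K + 1) (lo hi : ℝ)
    (hmem : ∀ i ∈ s, v i ∈ Set.Icc lo hi) {u : ℝ} (hu : 0 < u) :
    ∃ ξ ∈ Set.Icc lo hi, ∑ i ∈ s, u ^ v i / ∏ j ∈ s.erase i, (v i - v j) =
      Real.log u ^ K / K.factorial * u ^ ξ := by
  set P := Lagrange.interpolate s v (fun i => u ^ v i) with hP
  have hdeg : P.degree < s.card := Lagrange.degree_interpolate_lt _ hv
  have heval : ∀ i ∈ s, P.eval (v i) = u ^ v i := fun i hi =>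
    Lagrange.eval_interpolate_at_node _ hv hi
  have hcoeff : P.coeff K = ∑ i ∈ s, u ^ v i / ∏ j ∈ s.erase i, (v i - v j) := by
    have := Lagrange.coeff_eq_sum hv hdeg
    rw [hs, Nat.add_sub_cancel] at this
    rw [this]
    exact Finset.sum_congr rfl fun i hi => by rw [heval i hi]
  set f : ℕ → ℝ → ℝ := fun k t =>
    Real.log u ^ k * u ^ t - (Polynomial.derivative^[k] P).eval t with hf
  have hderiv : ∀ k t, HasDerivAt (f k) (f (k + 1) t) t := by
    intro k t
    have h1 := (Real.hasStrictDerivAt_const_rpow hu t).hasDerivAt.const_mul (Real.log u ^ k)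
    have h2 := (Polynomial.derivative^[k] P).hasDerivAt t
    refine HasDerivAt.congr_deriv (h1.sub h2) ?_
    simp only [hf, Function.iterate_succ_apply', pow_succ]
    ring
  have hcard : (s.image v).card = K + 1 := by rw [Finset.card_image_of_injOn hv, hs]
  obtain ⟨ξ, hξ, hξ0⟩ := exists_zero_of_strictMono_zeros hderiv K lo hi
    ((s.image v).orderEmbOfFin hcard) (OrderEmbedding.strictMono _)
    (fun i => by
      obtain ⟨a, ha, hae⟩ := Finset.mem_image.1 (Finset.orderEmbOfFin_mem (s.image v) hcard i)
      rw [← hae]; exact hmem a ha)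
    (fun i => by
      obtain ⟨a, ha, hae⟩ := Finset.mem_image.1 (Finset.orderEmbOfFin_mem (s.image v) hcard i)
      rw [← hae]
      simp [hf, heval a ha])
  refine ⟨ξ, hξ, ?_⟩
  have hnat : P.natDegree ≤ K := by
    rw [hs] at hdeg
    exact Polynomial.natDegree_le_of_degree_le (Order.lt_succ_iff.1 (by exact_mod_cast hdeg))
  have hconst : Polynomial.derivative^[K] P = Polynomial.C (K.factorial * P.coeff K) := by
    rw [Polynomial.eq_C_of_natDegree_eq_zero (p := Polynomial.derivative^[K] P)
      (by have := Polynomial.natDegree_iterate_derivative P K; omega)]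
    congr 1
    rw [Polynomial.coeff_iterate_derivative]
    simp [Nat.descFactorial_self]
  simp only [hf, hconst, Polynomial.eval_C, hcoeff] at hξ0
  have hK : (K.factorial : ℝ) ≠ 0 := by positivity
  field_simp
  linarith

/-- The contribution of the nodes of the same block to the divided difference. -/
theorem exists_int_mul_prod_erase_eq (w k : ℕ) (hk : k < w) :
    ∃ c : ℤ, |c| ≤ 2 ^ w ∧
      c * ∏ k' ∈ (Finset.range w).erase k, ((k : ℤ) - k') = (w - 1).factorial := by
  have hsplit : ∏ k' ∈ (Finset.range w).erase k, ((k : ℤ) - k') =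
      k.factorial * ((-1) ^ (w - 1 - k) * (w - 1 - k).factorial) := by
    obtain ⟨t, rfl⟩ : ∃ t, w = k + 1 + t := ⟨w - (k + 1), by omega⟩
    have hset : (Finset.range (k + 1 + t)).erase k =
        (Finset.range k) ∪ (Finset.range t).image (fun i => k + 1 + i) := by
      ext i
      simp only [Finset.mem_erase, Finset.mem_range, Finset.mem_union, Finset.mem_image]
      constructor
      · rintro ⟨h1, h2⟩
        rcases lt_or_gt_of_ne h1 with h | h
        · exact Or.inl h
        · exact Or.inr ⟨i - (k + 1), by omega, by omega⟩
      · rintro (h | ⟨j, hj, rfl⟩) <;> omega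
    rw [hset, Finset.prod_union, Finset.prod_image (by intro a _ b _ h; simpa using h)]
    · congr 1
      · rw [← Finset.prod_range_reflect, ← Finset.prod_range_add_one_eq_factorial]
        push_cast
        refine Finset.prod_congr rfl fun i hi => ?_
        have := Finset.mem_range.1 hi
        rw [Nat.cast_sub (by omega), Nat.cast_sub (by omega)]
        push_cast; ring
      · have h : k + 1 + t - 1 - k = t := by omega
        rw [h, ← Finset.prod_range_add_one_eq_factorial]
        push_cast
        rw [show ((-1 : ℤ) ^ t) = ∏ _i ∈ Finset.range t, (-1 : ℤ) by simp,
          ← Finset.prod_mul_distrib]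
        refine Finset.prod_congr rfl fun i _ => ?_
        ring
    · rw [Finset.disjoint_left]
      intro i hi hi'
      obtain ⟨j, _, rfl⟩ := Finset.mem_image.1 hi'
      have := Finset.mem_range.1 hi
      omega
  refine ⟨(-1) ^ (w - 1 - k) * (w - 1).choose k, ?_, ?_⟩
  · rw [abs_mul, abs_pow, abs_neg, abs_one, one_pow, one_mul, Nat.abs_cast]
    have h1 := Nat.choose_le_two_pow (w - 1) k
    have h2 : 2 ^ (w - 1) ≤ 2 ^ w := Nat.pow_le_pow_right (by norm_num) (by omega)
    exact_mod_cast h1.trans h2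
  · rw [hsplit]
    have h1 := Nat.choose_mul_factorial_mul_factorial (show k ≤ w - 1 by omega)
    rw [← h1]
    push_cast
    have h2 : ((-1 : ℤ) ^ (w - 1 - k)) * (-1) ^ (w - 1 - k) = 1 := by
      rw [← mul_pow]; simp
    linear_combination ((w - 1).choose k * k.factorial * (w - 1 - k).factorial : ℤ) * h2

theorem exists_int_mul_prod_eq_of_pos (w Y y : ℕ) (hy : w ≤ y) (hyY : y ≤ Y) :
    ∃ c : ℤ, |c| ≤ Nat.lcmUpto Y ∧
      c * ∏ k' ∈ Finset.range w, ((y : ℤ) - k') = w.factorial * Nat.lcmUpto Y := by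
  have hprod : ∏ k' ∈ Finset.range w, ((y : ℤ) - k') = w.factorial * y.choose w := by
    rw [← Nat.cast_mul, ← Nat.descFactorial_eq_factorial_mul_choose,
      Nat.descFactorial_eq_prod_range, Nat.cast_prod]
    refine Finset.prod_congr rfl fun i hi => ?_
    have := Finset.mem_range.1 hi
    rw [Nat.cast_sub (by omega)]
  have hdvd : y.choose w ∣ Nat.lcmUpto Y :=
    (Chebyshev.choose_dvd_lcmUpto hy).trans
      (Finset.lcm_mono (Finset.Icc_subset_Icc le_rfl hyY))
  obtain ⟨c, hc⟩ := hdvd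
  have hpos : 0 < y.choose w := Nat.choose_pos hy
  refine ⟨c, ?_, ?_⟩
  · rw [hc, Nat.abs_cast]
    exact_mod_cast Nat.le_mul_of_pos_left c hpos
  · rw [hprod, hc]; push_cast; ring

/-- The contribution of the nodes of another block, at distance `d`, to the divided difference. -/
theorem exists_int_mul_prod_eq (w Y k : ℕ) (hk : k < w) (d : ℤ) (hd : 2 * (w : ℤ) ≤ |d|)
    (hY : |d| + w ≤ Y) :
    ∃ c : ℤ, |c| ≤ Nat.lcmUpto Y ∧
      c * ∏ k' ∈ Finset.range w, ((k : ℤ) - k' + d) = w.factorial * Nat.lcmUpto Y := by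
  rcases le_total 0 d with h | h
  · rw [abs_of_nonneg h] at hd hY
    obtain ⟨c, hc1, hc2⟩ := exists_int_mul_prod_eq_of_pos w Y (k + d.toNat) (by omega) (by omega)
    refine ⟨c, hc1, ?_⟩
    rw [← hc2]
    congr 1
    refine Finset.prod_congr rfl fun i _ => ?_
    push_cast
    rw [Int.toNat_of_nonneg h]; ring
  · rw [abs_of_nonpos h] at hd hY
    obtain ⟨c, hc1, hc2⟩ := exists_int_mul_prod_eq_of_pos w Y ((-d).toNat + (w - 1) - k)
      (by omega) (by omega)
    refine ⟨(-1) ^ w * c, by simpa [abs_mul] using hc1, ?_⟩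
    rw [← hc2, ← Finset.prod_range_reflect]
    have : ∏ j ∈ Finset.range w, ((k : ℤ) - ((w - 1 - j : ℕ) : ℤ) + d) =
        (-1) ^ w * ∏ k' ∈ Finset.range w, ((((-d).toNat + (w - 1) - k : ℕ) : ℤ) - k') := by
      rw [show ((-1 : ℤ) ^ w) = ∏ _i ∈ Finset.range w, (-1 : ℤ) by simp,
        ← Finset.prod_mul_distrib]
      refine Finset.prod_congr rfl fun i hi => ?_
      have := Finset.mem_range.1 hi
      omega
    rw [this]
    have h2 : ((-1 : ℤ) ^ w) * (-1) ^ w = 1 := by rw [← mul_pow]; simp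
    linear_combination (c * ∏ k' ∈ Finset.range w,
      ((((-d).toNat + (w - 1) - k : ℕ) : ℤ) - k')) * h2

/-- An integer combination of the powers `u ^ (7 * q + k - j * R)` with `k < 4 * q` and `j < 3`,
proportional to a divided difference of `t ↦ u ^ t`. -/
theorem exists_int_coeff_sum_zpow_eq (q R : ℕ) (hq : 1 ≤ q) (hR : 13 * q ≤ R) :
    ∃ c : ℕ × ℕ → ℤ,
      (∀ p ∈ Finset.range (4 * q) ×ˢ Finset.range 3,
        |c p| ≤ 2 ^ (4 * q) * (Nat.lcmUpto (2 * R + 4 * q) : ℤ) ^ 2) ∧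
      ∀ u : ℝ, 0 < u → ∃ ξ : ℝ, |ξ| ≤ 2 * R ∧
        ∑ p ∈ Finset.range (4 * q) ×ˢ Finset.range 3,
          (c p : ℝ) * u ^ ((7 * q + p.1 : ℤ) - p.2 * R) =
        ((4 * q - 1).factorial * ((4 * q).factorial * Nat.lcmUpto (2 * R + 4 * q)) ^ 2 : ℕ) *
          (Real.log u ^ (12 * q - 1) / (12 * q - 1).factorial * u ^ ξ) := by
  set w := 4 * q with hw
  set Λ := Nat.lcmUpto (2 * R + w) with hΛ
  set s := Finset.range w ×ˢ Finset.range 3 with hs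
  set n : ℕ × ℕ → ℤ := fun p => (7 * q + p.1 : ℤ) - p.2 * R with hn
  have hninj : Set.InjOn n s := by
    rintro ⟨k, j⟩ h ⟨k', j'⟩ h' heq
    simp only [hs, Finset.coe_product, Finset.coe_range, Set.mem_prod, Set.mem_Iio] at h h'
    simp only [hn] at heq
    obtain ⟨hk, hj⟩ := h
    obtain ⟨hk', hj'⟩ := h'
    have : j = j' := by
      interval_cases j <;> interval_cases j' <;> first | rfl | (exfalso; push_cast at heq; omega)
    subst this
    simp only [Prod.mk.injEq, and_true]
    omega
  have hcoef : ∀ p ∈ s, ∃ c : ℤ, |c| ≤ 2 ^ w * (Λ : ℤ) ^ 2 ∧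
      c * ∏ p' ∈ s.erase p, (n p - n p') = ((w - 1).factorial * (w.factorial * Λ) ^ 2 : ℕ) := by
    rintro ⟨k, j⟩ hp
    obtain ⟨hk, hj⟩ := Finset.mem_product.1 hp
    have hk' : k < w := Finset.mem_range.1 hk
    have hj3 : j < 3 := Finset.mem_range.1 hj
    have hset : s.erase (k, j) = ((Finset.range w).erase k ×ˢ {j}) ∪
        (Finset.range w ×ˢ (Finset.range 3).erase j) := by
      ext ⟨k', j'⟩
      simp only [hs, Finset.mem_erase, Finset.mem_product, Finset.mem_union, Finset.mem_singleton,
        ne_eq, Prod.mk.injEq, Finset.mem_range]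
      by_cases h : j' = j
      · subst h; tauto
      · tauto
    obtain ⟨c₀, hc₀, hc₀'⟩ := exists_int_mul_prod_erase_eq w k hk'
    have hother : ∀ j' ∈ (Finset.range 3).erase j, ∃ c : ℤ, |c| ≤ Λ ∧
        c * ∏ k' ∈ Finset.range w, (n (k, j) - n (k', j')) = w.factorial * Λ := by
      intro j' hj'
      obtain ⟨hne, hj'3⟩ := Finset.mem_erase.1 hj'
      have hj'3 := Finset.mem_range.1 hj'3
      have hd : (R : ℤ) ≤ |((j' : ℤ) - j) * R| ∧ |((j' : ℤ) - j) * R| ≤ 2 * R := by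
        rw [abs_mul, Nat.abs_cast]
        have h1 : 1 ≤ |(j' : ℤ) - j| := by exact Int.one_le_abs (by omega)
        have h2 : |(j' : ℤ) - j| ≤ 2 := by rw [abs_le]; omega
        constructor <;> nlinarith [Int.natCast_nonneg R]
      obtain ⟨c, hc, hc'⟩ := exists_int_mul_prod_eq w (2 * R + w) k hk' (((j' : ℤ) - j) * R)
        (by omega) (by push_cast; omega)
      refine ⟨c, hc, ?_⟩
      rw [← hc']
      congr 1
      refine Finset.prod_congr rfl fun i _ => ?_
      simp only [hn]; ring
    choose! d hd hd' using hother
    refine ⟨c₀ * ∏ j' ∈ (Finset.range 3).erase j, d j', ?_, ?_⟩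
    · rw [abs_mul, Finset.abs_prod]
      have h1 : ∏ j' ∈ (Finset.range 3).erase j, |d j'| ≤ (Λ : ℤ) ^ 2 := by
        have h2 : ((Finset.range 3).erase j).card = 2 := by rw [Finset.card_erase_of_mem hj]; simp
        calc ∏ j' ∈ (Finset.range 3).erase j, |d j'|
            ≤ ∏ j' ∈ (Finset.range 3).erase j, (Λ : ℤ) :=
              Finset.prod_le_prod (fun _ _ => abs_nonneg _) hd
          _ = (Λ : ℤ) ^ 2 := by rw [Finset.prod_const, h2]
      gcongr
    · rw [hset, Finset.prod_union, Finset.prod_product, Finset.prod_product_right]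
      · simp only [Finset.prod_singleton]
        have h1 : ∏ x ∈ (Finset.range w).erase k, (n (k, j) - n (x, j)) =
            ∏ x ∈ (Finset.range w).erase k, ((k : ℤ) - x) :=
          Finset.prod_congr rfl fun i _ => by simp only [hn]; ring
        rw [h1, mul_mul_mul_comm, hc₀', ← Finset.prod_mul_distrib, Finset.prod_congr rfl hd',
          Finset.prod_const, Finset.card_erase_of_mem hj]
        simp
      · rw [Finset.disjoint_left]
        rintro ⟨k', j'⟩ h h'
        simp only [Finset.mem_product, Finset.mem_erase, Finset.mem_singleton] at h h'
        exact h'.2.1 h.2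
  choose! c hc hc' using hcoef
  refine ⟨c, hc, fun u hu => ?_⟩
  obtain ⟨ξ, hξ, hsum⟩ := exists_sum_rpow_div_prod_eq s (fun p => (n p : ℝ))
    (fun a ha b hb h => hninj ha hb (Int.cast_injective h)) (12 * q - 1)
    (by rw [hs, Finset.card_product, Finset.card_range, Finset.card_range]; omega)
    (-(2 * R)) (2 * R)
    (by
      rintro ⟨k, j⟩ hp
      obtain ⟨hk, hj⟩ := Finset.mem_product.1 hp
      have hk' : k < w := Finset.mem_range.1 hk
      have hj3 : j < 3 := Finset.mem_range.1 hj
      have : -(2 * (R : ℤ)) ≤ n (k, j) ∧ n (k, j) ≤ 2 * R := by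
        simp only [hn]
        constructor
        · have : (j : ℤ) * R ≤ 2 * R := by
            have : (j : ℤ) ≤ 2 := by omega
            nlinarith [Int.natCast_nonneg R]
          omega
        · have : 0 ≤ (j : ℤ) * R := by positivity
          omega
      exact ⟨by exact_mod_cast this.1, by exact_mod_cast this.2⟩) hu
  refine ⟨ξ, abs_le.2 hξ, ?_⟩
  rw [← hsum, Finset.mul_sum]
  refine Finset.sum_congr rfl fun p hp => ?_
  have hne : ∏ p' ∈ s.erase p, ((n p : ℝ) - n p') ≠ 0 := by
    rw [Finset.prod_ne_zero_iff]
    intro p' hp' h0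
    obtain ⟨h1, h2⟩ := Finset.mem_erase.1 hp'
    exact h1 (hninj h2 hp (by have := sub_eq_zero.1 h0; exact_mod_cast this.symm))
  have hcp : (c p : ℝ) * ∏ p' ∈ s.erase p, ((n p : ℝ) - n p') =
      ((w - 1).factorial * (w.factorial * Λ) ^ 2 : ℕ) := by exact_mod_cast hc' p hp
  rw [← hcp, Real.rpow_intCast]
  field_simp
  rfl

theorem lcmUpto_le_exp (n : ℕ) : (Nat.lcmUpto n : ℝ) ≤ Real.exp (6 * n) := by
  have h1 := Chebyshev.psi_le_const_mul_self (Nat.cast_nonneg (α := ℝ) n)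
  rw [Chebyshev.psi_eq_log_lcmUpto] at h1
  have h2 : Real.log 4 ≤ 2 := by
    rw [show (4 : ℝ) = 2 ^ 2 by norm_num, Real.log_pow]
    have := Real.log_two_lt_d9
    push_cast; linarith
  have hpos : (0 : ℝ) < Nat.lcmUpto n := by exact_mod_cast Nat.lcmUpto_pos n
  rw [← Real.log_le_iff_le_exp hpos]
  have : (0 : ℝ) ≤ n := Nat.cast_nonneg n
  nlinarith

theorem factorial_three_mul_sub_one_le (w : ℕ) (hw : 1 ≤ w) :
    (3 * w - 1).factorial ≤ 32 ^ w * ((w - 1).factorial * w.factorial ^ 2) := by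
  have h1 := Nat.add_choose_mul_factorial_mul_factorial (w - 1) (2 * w)
  have h2 := Nat.add_choose_mul_factorial_mul_factorial w w
  have e1 : w - 1 + 2 * w = 3 * w - 1 := by omega
  have e2 : w + w = 2 * w := by omega
  rw [e1] at h1
  rw [e2] at h2
  have h3 : (3 * w - 1).choose (2 * w) ≤ 2 ^ (3 * w) :=
    (Nat.choose_le_two_pow _ _).trans (Nat.pow_le_pow_right (by norm_num) (by omega))
  have h4 : (2 * w).choose w ≤ 2 ^ (2 * w) := Nat.choose_le_two_pow _ _
  calc (3 * w - 1).factorial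
      = (3 * w - 1).choose (2 * w) * (2 * w).choose w *
          ((w - 1).factorial * w.factorial ^ 2) := by
        rw [← h1, ← h2]; ring
    _ ≤ 2 ^ (3 * w) * 2 ^ (2 * w) * ((w - 1).factorial * w.factorial ^ 2) := by gcongr
    _ = 32 ^ w * ((w - 1).factorial * w.factorial ^ 2) := by
        rw [← pow_add, show 3 * w + 2 * w = 5 * w by ring, pow_mul]; norm_num

theorem abs_log_le_log_two {u : ℝ} (h1 : 1 / 2 ≤ u) (h2 : u ≤ 2) :
    |Real.log u| ≤ Real.log 2 := by
  have hu : 0 < u := by linarith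
  rw [abs_le]
  constructor
  · rw [← Real.log_inv]
    exact Real.log_le_log (by norm_num) (by linarith)
  · exact Real.log_le_log hu h2

theorem rpow_le_two_pow {u ξ : ℝ} {n : ℕ} (h1 : 1 / 2 ≤ u) (h2 : u ≤ 2) (hξ : |ξ| ≤ n) :
    u ^ ξ ≤ 2 ^ n := by
  have hu : 0 < u := by linarith
  rw [← Real.rpow_natCast, Real.rpow_def_of_pos hu, Real.rpow_def_of_pos (by norm_num)]
  refine Real.exp_le_exp.2 ?_
  calc Real.log u * ξ ≤ |Real.log u * ξ| := le_abs_self _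
    _ = |Real.log u| * |ξ| := abs_mul _ _
    _ ≤ Real.log 2 * n := by
      gcongr
      exact abs_log_le_log_two h1 h2

/-- Quantitative form of `exists_int_coeff_sum_zpow_eq`. -/
theorem exists_int_coeff_sum_zpow_bounds :
    ∃ A : ℝ, 1 ≤ A ∧ ∀ q R : ℕ, 1 ≤ q → 13 * q ≤ R → R ≤ 16 * q →
      ∃ c : ℕ × ℕ → ℤ,
        (∀ p ∈ Finset.range (4 * q) ×ˢ Finset.range 3, |(c p : ℝ)| ≤ A ^ q) ∧
        ∀ u : ℝ, 1 / 2 ≤ u → u ≤ 2 →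
          |Real.log u| ^ (12 * q - 1) ≤ A ^ q * |∑ p ∈ Finset.range (4 * q) ×ˢ Finset.range 3,
            (c p : ℝ) * u ^ ((7 * q + p.1 : ℤ) - p.2 * R)| ∧
          |∑ p ∈ Finset.range (4 * q) ×ˢ Finset.range 3,
            (c p : ℝ) * u ^ ((7 * q + p.1 : ℤ) - p.2 * R)| ≤
              A ^ q * |Real.log u| ^ (12 * q - 1) := by
  refine ⟨2 ^ 52 * Real.exp 432, ?_, ?_⟩
  · have : 1 ≤ Real.exp 432 := Real.one_le_exp (by norm_num)
    nlinarith
  intro q R hq hR hR'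
  obtain ⟨c, hc, hsum⟩ := exists_int_coeff_sum_zpow_eq q R hq hR
  set Λ := Nat.lcmUpto (2 * R + 4 * q) with hΛ
  have hΛ1 : (1 : ℝ) ≤ Λ := by exact_mod_cast Nat.lcmUpto_pos _
  have hΛ2 : (Λ : ℝ) ^ 2 ≤ Real.exp 432 ^ q := by
    have h := lcmUpto_le_exp (2 * R + 4 * q)
    have h2 : (Λ : ℝ) ≤ Real.exp (216 * q) := by
      refine h.trans (Real.exp_le_exp.2 ?_)
      have : (R : ℝ) ≤ 16 * q := by exact_mod_cast hR'
      push_cast; linarith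
    calc (Λ : ℝ) ^ 2 ≤ Real.exp (216 * q) ^ 2 := by gcongr
      _ = Real.exp 432 ^ q := by
        rw [← Real.exp_nat_mul, ← Real.exp_nat_mul]; push_cast; ring_nf
  have hexp : 1 ≤ Real.exp 432 ^ q := one_le_pow₀ (Real.one_le_exp (by norm_num))
  refine ⟨c, fun p hp => ?_, fun u hu1 hu2 => ?_⟩
  · have h1 : |(c p : ℝ)| ≤ 2 ^ (4 * q) * (Λ : ℝ) ^ 2 := by exact_mod_cast hc p hp
    calc |(c p : ℝ)| ≤ 2 ^ (4 * q) * (Λ : ℝ) ^ 2 := h1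
      _ ≤ 2 ^ (52 * q) * Real.exp 432 ^ q := by
        gcongr
        · norm_num
        · norm_num
      _ = (2 ^ 52 * Real.exp 432) ^ q := by rw [mul_pow, ← pow_mul]
  · have hu : 0 < u := by linarith
    obtain ⟨ξ, hξ, hS⟩ := hsum u hu
    rw [hS]
    set K := 12 * q - 1 with hK
    have hK3 : K = 3 * (4 * q) - 1 := by omega
    have hξ' : |ξ| ≤ (32 * q : ℕ) := by
      have : (R : ℝ) ≤ 16 * q := by exact_mod_cast hR'
      push_cast; linarith
    have hup : u ^ ξ ≤ 2 ^ (32 * q) := rpow_le_two_pow hu1 hu2 hξ'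
    have hlow : 1 ≤ 2 ^ (32 * q) * u ^ ξ := by
      have h := rpow_le_two_pow (ξ := -ξ) hu1 hu2 (by rwa [abs_neg])
      rw [Real.rpow_neg hu.le] at h
      have hpos : 0 < u ^ ξ := Real.rpow_pos_of_pos hu ξ
      rw [inv_le_iff_one_le_mul₀ hpos] at h
      exact h
    set P : ℕ := (4 * q - 1).factorial * (4 * q).factorial ^ 2 with hP
    have hPpos : (0 : ℝ) < P := by rw [hP]; positivity
    have hKpos : (0 : ℝ) < K.factorial := by positivity
    have hP1 : (P : ℝ) ≤ K.factorial := by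
      have h1 := Nat.factorial_mul_factorial_dvd_factorial_add (4 * q) (4 * q)
      have h2 := Nat.factorial_mul_factorial_dvd_factorial_add (4 * q - 1) (4 * q + 4 * q)
      have h3 : 4 * q - 1 + (4 * q + 4 * q) = K := by omega
      rw [h3] at h2
      have h4 := Nat.le_of_dvd (Nat.factorial_pos _) ((mul_dvd_mul_left _ h1).trans h2)
      rw [← sq] at h4
      exact_mod_cast h4
    have hP2 : (K.factorial : ℝ) ≤ 2 ^ (20 * q) * P := by
      have := factorial_three_mul_sub_one_le (4 * q) (by omega)
      rw [← hK3, show (32 : ℕ) = 2 ^ 5 by norm_num, ← pow_mul,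
        show 5 * (4 * q) = 20 * q by ring] at this
      exact_mod_cast this
    have habs : |(((4 * q - 1).factorial * ((4 * q).factorial * Λ) ^ 2 : ℕ) : ℝ) *
        (Real.log u ^ K / K.factorial * u ^ ξ)| =
        (P : ℝ) / K.factorial * (Λ : ℝ) ^ 2 * u ^ ξ * |Real.log u| ^ K := by
      rw [abs_mul, abs_mul, abs_div, abs_pow, abs_of_pos hKpos,
        abs_of_pos (Real.rpow_pos_of_pos hu ξ), Nat.abs_cast, hP]
      push_cast; ring
    rw [habs]
    have hPK1 : (P : ℝ) / K.factorial ≤ 1 := (div_le_one hKpos).2 hP1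
    have hPK2 : 1 ≤ 2 ^ (20 * q) * ((P : ℝ) / K.factorial) := by
      rw [← mul_div_assoc, le_div_iff₀ hKpos, one_mul]; exact hP2
    have hsplit : ((2 : ℝ) ^ 52 * Real.exp 432) ^ q =
        2 ^ (20 * q) * 2 ^ (32 * q) * Real.exp 432 ^ q := by
      rw [mul_pow, ← pow_mul, ← pow_add]; ring_nf
    rw [hsplit]
    have hl : 0 ≤ |Real.log u| ^ K := by positivity
    constructor
    · have h1 : 1 ≤ (2 : ℝ) ^ (20 * q) * 2 ^ (32 * q) * Real.exp 432 ^ q *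
          ((P : ℝ) / K.factorial * (Λ : ℝ) ^ 2 * u ^ ξ) := by
        calc (1 : ℝ) = 1 * 1 * 1 * 1 := by norm_num
          _ ≤ (2 ^ (20 * q) * ((P : ℝ) / K.factorial)) * (2 ^ (32 * q) * u ^ ξ) *
              Real.exp 432 ^ q * (Λ : ℝ) ^ 2 := by
            gcongr
            exact one_le_pow₀ hΛ1
          _ = _ := by ring
      nlinarith
    · refine mul_le_mul_of_nonneg_right ?_ hl
      calc (P : ℝ) / K.factorial * (Λ : ℝ) ^ 2 * u ^ ξ
          ≤ 1 * Real.exp 432 ^ q * 2 ^ (32 * q) := by gcongr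
        _ ≤ 2 ^ (20 * q) * 2 ^ (32 * q) * Real.exp 432 ^ q := by
          have : (1 : ℝ) ≤ 2 ^ (20 * q) := one_le_pow₀ (by norm_num)
          have h2 : (0 : ℝ) ≤ 2 ^ (32 * q) * Real.exp 432 ^ q := by positivity
          nlinarith

open Real goldenRatio in
/-- The trace of the algebraic integer `√5 ^ k * φ ^ g` is an integer. -/
theorem exists_int_sqrt_five_pow_trace (k g : ℕ) :
    ∃ t : ℤ, (t : ℝ) = √5 ^ k * φ ^ g + (-√5) ^ k * ψ ^ g := by
  suffices h : ∃ p r : ℤ, √5 ^ k * φ ^ g = p + r * φ ∧ (-√5) ^ k * ψ ^ g = p + r * ψ by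
    obtain ⟨p, r, h1, h2⟩ := h
    refine ⟨2 * p + r, ?_⟩
    rw [h1, h2]
    push_cast
    linear_combination (-(r : ℝ)) * goldenRatio_add_goldenConj
  have h5 : √5 = 2 * φ - 1 := by
    rw [← goldenRatio_sub_goldenConj]
    linear_combination -goldenRatio_add_goldenConj
  have h5' : -√5 = 2 * ψ - 1 := by
    rw [← goldenRatio_sub_goldenConj]
    linear_combination -goldenRatio_add_goldenConj
  induction k with
  | zero =>
    induction g with
    | zero => exact ⟨1, 0, by simp, by simp⟩
    | succ g ih =>
      obtain ⟨p, r, h1, h2⟩ := ih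
      refine ⟨r, p + r, ?_, ?_⟩
      · rw [pow_succ, ← mul_assoc, h1]; push_cast
        linear_combination (r : ℝ) * goldenRatio_sq
      · rw [pow_succ, ← mul_assoc, h2]; push_cast
        linear_combination (r : ℝ) * goldenConj_sq
  | succ k ih =>
    obtain ⟨p, r, h1, h2⟩ := ih
    refine ⟨2 * r - p, 2 * p + r, ?_, ?_⟩
    · rw [pow_succ, mul_right_comm, h1, h5]; push_cast
      linear_combination 2 * (r : ℝ) * goldenRatio_sq
    · rw [pow_succ, mul_right_comm, h2, h5']; push_cast
      linear_combination 2 * (r : ℝ) * goldenConj_sq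

open Real goldenRatio in
/-- The monomial `u ^ e * v ^ j`, where `u = φ ^ a / (√5 * 2 ^ m₁)` and `v = φ ^ b / (√5 * 2 ^ m₂)`,
is up to a small error `κ` a rational number with controlled denominator. -/
theorem exists_int_eq_monomial_add {a b m₁ m₂ j r M E : ℕ} {e : ℤ} {u v : ℝ} (hu : 0 < u)
    (hv : 0 < v) (hua : φ ^ a = u * (√5 * 2 ^ m₁)) (hvb : φ ^ b = v * (√5 * 2 ^ m₂))
    (hr : (m₁ : ℤ) * e + m₂ * j = r) (hM : r ≤ M) (hE : e + j ≤ E)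
    (hge : 1 ≤ u ^ e * v ^ j * √5 ^ (e + j) * 2 ^ r) :
    ∃ I : ℤ, ∃ κ : ℝ, (I : ℝ) = 2 ^ M * √5 ^ E * (u ^ e * v ^ j + κ) ∧
      |κ| * (u ^ e * v ^ j * 5 ^ (e + j) * 4 ^ r) = 1 := by
  have h5 : (√5 : ℝ) ≠ 0 := by positivity
  have hφ : φ ^ ((a : ℤ) * e + b * j) = u ^ e * v ^ j * √5 ^ (e + j) * 2 ^ r := by
    rw [zpow_add₀ goldenRatio_ne_zero, zpow_mul, zpow_mul, zpow_natCast, zpow_natCast, zpow_natCast,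
      hua, hvb,
      mul_zpow, mul_zpow, ← zpow_natCast (2 : ℝ) m₁, ← zpow_mul, mul_pow, mul_pow,
      ← pow_mul, zpow_add₀ h5, ← zpow_natCast (2 : ℝ) r, ← hr, zpow_add₀ two_ne_zero,
      zpow_natCast √5 j]
    rw [← zpow_natCast (2 : ℝ) (m₂ * j)]
    push_cast
    ring
  have hg : 0 ≤ (a : ℤ) * e + b * j := by
    by_contra! hlt
    have := zpow_lt_one_of_neg₀ one_lt_goldenRatio hlt
    rw [hφ] at this
    linarith
  obtain ⟨g, hg⟩ := Int.eq_ofNat_of_zero_le hg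
  obtain ⟨k, hk⟩ : ∃ k : ℕ, (E : ℤ) = e + j + k := ⟨(E - (e + j)).toNat, by omega⟩
  obtain ⟨t, ht⟩ := exists_int_sqrt_five_pow_trace k g
  rw [hg, zpow_natCast] at hφ
  have hE' : √5 ^ E = √5 ^ (e + j) * √5 ^ k := by
    rw [← zpow_natCast √5 E, hk, zpow_add₀ h5, zpow_natCast]
  have hM' : (2 : ℝ) ^ M = 2 ^ r * 2 ^ (M - r) := by rw [← pow_add]; congr 1; omega
  have hz : √5 ^ (e + j) ≠ 0 := zpow_ne_zero _ h5
  refine ⟨2 ^ (M - r) * t, (-1) ^ k * ψ ^ g / (√5 ^ (e + j) * 2 ^ r), ?_, ?_⟩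
  · push_cast
    rw [ht, hE', hM', hφ, show (-√5) ^ k = (-1) ^ k * √5 ^ k by rw [← mul_pow]; ring]
    field_simp
  · have hψ : |ψ ^ g| * φ ^ g = 1 := by
      rw [abs_pow, ← mul_pow, abs_of_neg goldenConj_neg, neg_mul, goldenConj_mul_goldenRatio]
      simp
    rw [abs_div, abs_mul, abs_pow, abs_neg, abs_one, one_pow, one_mul,
      abs_of_pos (by positivity : (0 : ℝ) < √5 ^ (e + j) * 2 ^ r)]
    have h5z : (5 : ℝ) ^ (e + j) = √5 ^ (e + j) * √5 ^ (e + j) := by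
      rw [← mul_zpow, Real.mul_self_sqrt (by norm_num)]
    have h4 : (4 : ℝ) ^ r = 2 ^ r * 2 ^ r := by rw [← mul_pow]; norm_num
    rw [h5z, h4, ← hψ, hφ]
    field_simp

open Real goldenRatio in
/-- If `F_a` is close to `2 ^ m`, then `φ ^ a / (√5 * 2 ^ m)` is close to `1`. -/
theorem abs_ratio_sub_one_bounds {a m : ℕ} {X : ℝ} (hX : 1 ≤ X)
    (h : |(Nat.fib a : ℝ) - 2 ^ m| ≤ X) :
    |φ ^ a / (√5 * 2 ^ m) - 1| * 2 ^ m ≤ 2 * X ∧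
      (Nat.fib a ≠ 2 ^ m → 1 / 2 ≤ |φ ^ a / (√5 * 2 ^ m) - 1| * 2 ^ m) := by
  have h5 : (0 : ℝ) < √5 := by positivity
  have h5' : (2 : ℝ) ≤ √5 := Real.le_sqrt_of_sq_le (by norm_num)
  have hpow : (0 : ℝ) < 2 ^ m := by positivity
  have key : |φ ^ a / (√5 * 2 ^ m) - 1| * 2 ^ m =
      |((Nat.fib a : ℝ) - 2 ^ m) + ψ ^ a / √5| := by
    nth_rewrite 2 [← abs_of_pos hpow]
    rw [← abs_mul, coe_fib_eq]
    congr 1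
    field_simp
    ring
  have hψ : |ψ ^ a / √5| ≤ 1 / 2 := by
    rw [abs_div, abs_of_pos h5, div_le_iff₀ h5, abs_pow]
    have : |ψ| ^ a ≤ 1 := pow_le_one₀ (abs_nonneg _)
      (abs_le.2 ⟨neg_one_lt_goldenConj.le, by linarith [goldenConj_neg]⟩)
    linarith
  rw [key]
  constructor
  · have := abs_add_le ((Nat.fib a : ℝ) - 2 ^ m) (ψ ^ a / √5)
    linarith
  · intro hne
    have h1 : (1 : ℝ) ≤ |(Nat.fib a : ℝ) - 2 ^ m| := by
      have : (1 : ℤ) ≤ |(Nat.fib a : ℤ) - 2 ^ m| :=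
        Int.one_le_abs (sub_ne_zero.2 (by exact_mod_cast hne))
      exact_mod_cast this
    have h2 := abs_sub_abs_le_abs_sub ((Nat.fib a : ℝ) - 2 ^ m) (-(ψ ^ a / √5))
    rw [abs_neg, sub_neg_eq_add] at h2
    linarith

theorem zpow_le_two_pow {u : ℝ} {e : ℤ} {n : ℕ} (h1 : 1 / 2 ≤ u) (h2 : u ≤ 2) (he : |e| ≤ n) :
    u ^ e ≤ 2 ^ n := by
  rw [← Real.rpow_intCast]
  exact rpow_le_two_pow h1 h2 (by exact_mod_cast he)

theorem one_le_zpow_mul_two_pow {u : ℝ} {e : ℤ} {n : ℕ} (h1 : 1 / 2 ≤ u) (h2 : u ≤ 2)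
    (he : |e| ≤ n) : 1 ≤ u ^ e * 2 ^ n := by
  have hu : 0 < u := by linarith
  have h := zpow_le_two_pow h1 h2 (by rwa [abs_neg] : |-e| ≤ n)
  have := mul_le_mul_of_nonneg_left h (zpow_pos hu e).le
  rwa [← zpow_add₀ hu.ne', add_neg_cancel, zpow_zero] at this

open Real goldenRatio in
/-- The power `u ^ (7 * q + k - j * R)`, up to a small error `η`, is a rational number with
controlled denominator. -/
theorem exists_int_eq_zpow_add {a b m₁ s q R k j : ℕ} {u v X : ℝ} (hX : 1 ≤ X)
    (hB : 10 ^ 35 ≤ (2 : ℝ) ^ m₁) (hq : 1 ≤ q) (hR : 13 * q ≤ R) (hR' : R ≤ 16 * q)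
    (hs : s ≤ m₁) (hk : k < 4 * q) (hj : j < 3) (hu1 : 1 / 2 ≤ u) (hu2 : u ≤ 2)
    (hv1 : 1 / 2 ≤ v) (hv2 : v ≤ 2) (hua : φ ^ a = u * (√5 * 2 ^ m₁))
    (hvb : φ ^ b = v * (√5 * 2 ^ (m₁ * R + s))) (hv : |v - 1| * 2 ^ (m₁ * R + s) ≤ 2 * X) :
    ∃ I : ℤ, ∃ η : ℝ,
      (I : ℝ) = 2 ^ ((11 * q + 1) * m₁) * √5 ^ (12 * q) * (u ^ ((7 * q + k : ℤ) - j * R) + η) ∧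
      |η| * (2 ^ m₁) ^ (13 * q) ≤ 10 * 10 ^ (32 * q) * X := by
  have hu : 0 < u := by linarith
  have hv0 : 0 < v := by linarith
  set B : ℝ := 2 ^ m₁ with hBdef
  have hB1 : 1 ≤ B := le_trans (by norm_num) hB
  set e : ℤ := (7 * q + k : ℤ) - j * R with hedef
  have hjR : (j : ℤ) * R ≤ 32 * q := by
    have : j * R ≤ 2 * (16 * q) := Nat.mul_le_mul (by omega) hR'
    exact_mod_cast (by omega : j * R ≤ 32 * q)
  have hjR0 : 0 ≤ (j : ℤ) * R := by positivity
  have he : |e| ≤ ((32 * q : ℕ) : ℤ) := by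
    rw [abs_le]; push_cast; constructor <;> omega
  have hej : |e + j| ≤ ((32 * q : ℕ) : ℤ) := by
    rw [abs_le]; push_cast; constructor <;> omega
  set r : ℕ := m₁ * (7 * q + k) + j * s with hrdef
  have hr : (m₁ : ℤ) * e + ((m₁ * R + s : ℕ) : ℤ) * j = r := by
    rw [hedef, hrdef]; push_cast; ring
  have hrM : r ≤ (11 * q + 1) * m₁ := by
    have h1 : j * s ≤ 2 * m₁ := Nat.mul_le_mul (by omega) hs
    have h2 : m₁ * (7 * q + k) ≤ m₁ * (11 * q - 1) := Nat.mul_le_mul_left _ (by omega)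
    have h3 : m₁ * (11 * q - 1) + 2 * m₁ = (11 * q + 1) * m₁ := by
      rw [mul_comm m₁, ← add_mul]; congr 1; omega
    omega
  have h2r : B ^ (7 * q) ≤ 2 ^ r := by
    rw [hBdef, ← pow_mul]
    exact pow_le_pow_right₀ (by norm_num) (by
      rw [hrdef]; nlinarith [Nat.zero_le (j * s), Nat.zero_le (m₁ * k)])
  have hue := one_le_zpow_mul_two_pow hu1 hu2 he
  have hvj : 1 ≤ v ^ j * 4 := by interval_cases j <;> nlinarith
  have h5e : 1 ≤ (5 : ℝ) ^ (e + j) * 5 ^ (32 * q) := by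
    rw [← zpow_natCast (5 : ℝ), ← zpow_add₀ (by norm_num)]
    exact one_le_zpow₀ (by norm_num) (by linarith [(abs_le.1 hej).1])
  have hs5 : (1 : ℝ) ≤ √5 := Real.one_le_sqrt.2 (by norm_num)
  have hs5e : 1 ≤ √5 ^ (e + j) * 5 ^ (32 * q) := by
    have h1 : 1 ≤ √5 ^ (e + j) * √5 ^ (32 * q) := by
      rw [← zpow_natCast √5, ← zpow_add₀ (by positivity)]
      exact one_le_zpow₀ hs5 (by linarith [(abs_le.1 hej).1])
    refine h1.trans (mul_le_mul_of_nonneg_left ?_ (by positivity))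
    exact pow_le_pow_left₀ (by positivity) (Real.sqrt_le_self_iff.2 (Or.inr (by norm_num))) _
  have h10 : (2 : ℝ) ^ (32 * q) * 5 ^ (32 * q) = 10 ^ (32 * q) := by
    rw [← mul_pow]; norm_num
  have h10B : 4 * (10 : ℝ) ^ (32 * q) ≤ B ^ (7 * q) := by
    calc 4 * (10 : ℝ) ^ (32 * q) ≤ (10 ^ 35) ^ q := by
          rw [← pow_mul]
          calc 4 * (10 : ℝ) ^ (32 * q) ≤ 10 ^ (3 * q) * 10 ^ (32 * q) := by
                refine mul_le_mul_of_nonneg_right ?_ (by positivity)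
                exact le_trans (by norm_num) (pow_le_pow_right₀ (by norm_num) (by omega : 1 ≤ 3 * q))
            _ = _ := by rw [← pow_add]; congr 1; ring
      _ ≤ B ^ q := pow_le_pow_left₀ (by norm_num) hB _
      _ ≤ _ := pow_le_pow_right₀ hB1 (by omega)
  have hge : 1 ≤ u ^ e * v ^ j * √5 ^ (e + j) * 2 ^ r := by
    have h1 : 1 ≤ (u ^ e * 2 ^ (32 * q)) * (v ^ j * 4) * (√5 ^ (e + j) * 5 ^ (32 * q)) :=
      one_le_mul_of_one_le_of_one_le (one_le_mul_of_one_le_of_one_le hue hvj) hs5e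
    have h2 : (u ^ e * 2 ^ (32 * q)) * (v ^ j * 4) * (√5 ^ (e + j) * 5 ^ (32 * q)) =
        u ^ e * v ^ j * √5 ^ (e + j) * (4 * 10 ^ (32 * q)) := by rw [← h10]; ring
    rw [h2] at h1
    exact h1.trans (mul_le_mul_of_nonneg_left (h10B.trans h2r) (by positivity))
  obtain ⟨I, κ, hI, hκ⟩ := exists_int_eq_monomial_add (E := 12 * q) hu hv0 hua hvb hr hrM
    (by push_cast; omega) hge
  refine ⟨I, u ^ e * (v ^ j - 1) + κ, by rw [hI]; ring, ?_⟩
  have hκ' : |κ| * B ^ (13 * q) ≤ 4 * 10 ^ (32 * q) * X := by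
    have h4r : B ^ (13 * q) ≤ 4 ^ r := by
      calc B ^ (13 * q) ≤ B ^ (7 * q) * B ^ (7 * q) := by
            rw [← pow_add]; exact pow_le_pow_right₀ hB1 (by omega)
        _ ≤ 2 ^ r * 2 ^ r := mul_le_mul h2r h2r (by positivity) (by positivity)
        _ = 4 ^ r := by rw [← mul_pow]; norm_num
    have h1 : 1 ≤ (u ^ e * 2 ^ (32 * q)) * (v ^ j * 4) * (5 ^ (e + j) * 5 ^ (32 * q)) :=
      one_le_mul_of_one_le_of_one_le (one_le_mul_of_one_le_of_one_le hue hvj) h5e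
    calc |κ| * B ^ (13 * q) ≤ |κ| * 4 ^ r := mul_le_mul_of_nonneg_left h4r (abs_nonneg _)
      _ ≤ |κ| * 4 ^ r * ((u ^ e * 2 ^ (32 * q)) * (v ^ j * 4) * (5 ^ (e + j) * 5 ^ (32 * q))) :=
        le_mul_of_one_le_right (by positivity) h1
      _ = |κ| * (u ^ e * v ^ j * 5 ^ (e + j) * 4 ^ r) * (4 * 10 ^ (32 * q)) := by
        rw [← h10]; ring
      _ = 4 * 10 ^ (32 * q) := by rw [hκ, one_mul]
      _ ≤ _ := le_mul_of_one_le_right (by positivity) hX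
  have hvB : |v ^ j - 1| * B ^ (13 * q) ≤ 6 * X := by
    have h1 : |v ^ j - 1| ≤ 3 * |v - 1| := by
      have h0 := abs_nonneg (v - 1)
      interval_cases j
      · simp
      · rw [pow_one]; linarith
      · rw [show v ^ 2 - 1 = (v + 1) * (v - 1) by ring, abs_mul, abs_of_pos (by linarith)]
        exact mul_le_mul_of_nonneg_right (by linarith) h0
    have h2 : B ^ (13 * q) ≤ 2 ^ (m₁ * R + s) := by
      rw [hBdef, ← pow_mul]
      exact pow_le_pow_right₀ (by norm_num) (by nlinarith [Nat.mul_le_mul_left m₁ hR])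
    calc |v ^ j - 1| * B ^ (13 * q) ≤ (3 * |v - 1|) * 2 ^ (m₁ * R + s) :=
          mul_le_mul h1 h2 (by positivity) (by positivity)
      _ ≤ 6 * X := by linarith
  have hue2 := zpow_le_two_pow hu1 hu2 he
  have h210 : (2 : ℝ) ^ (32 * q) ≤ 10 ^ (32 * q) := pow_le_pow_left₀ (by norm_num) (by norm_num) _
  calc |u ^ e * (v ^ j - 1) + κ| * B ^ (13 * q)
      ≤ (|u ^ e * (v ^ j - 1)| + |κ|) * B ^ (13 * q) :=
        mul_le_mul_of_nonneg_right (abs_add_le _ _) (by positivity)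
    _ = u ^ e * (|v ^ j - 1| * B ^ (13 * q)) + |κ| * B ^ (13 * q) := by
        rw [abs_mul, abs_of_pos (zpow_pos hu e)]; ring
    _ ≤ 10 ^ (32 * q) * (6 * X) + 4 * 10 ^ (32 * q) * X :=
        add_le_add (mul_le_mul (hue2.trans h210) hvB (by positivity) (by positivity)) hκ'
    _ = _ := by ring

theorem half_abs_sub_one_le_abs_log {u : ℝ} (h1 : 1 / 2 ≤ u) (h2 : u ≤ 2) :
    |u - 1| / 2 ≤ |Real.log u| := by
  have hu : 0 < u := by linarith
  rcases le_total 1 u with h | h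
  · rw [abs_of_nonneg (by linarith), abs_of_nonneg (Real.log_nonneg h)]
    have := Real.one_sub_inv_le_log_of_pos hu
    have h3 : (u - 1) / 2 ≤ 1 - u⁻¹ := by
      rw [show 1 - u⁻¹ = (u - 1) / u by field_simp]
      exact div_le_div_of_nonneg_left (by linarith) hu h2
    linarith
  · rw [abs_of_nonpos (by linarith), abs_of_nonpos (Real.log_nonpos hu.le h)]
    have := Real.log_le_sub_one_of_pos hu
    linarith

theorem abs_log_le_two_mul_abs_sub_one {u : ℝ} (h1 : 1 / 2 ≤ u) :
    |Real.log u| ≤ 2 * |u - 1| := by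
  have hu : 0 < u := by linarith
  rcases le_total 1 u with h | h
  · rw [abs_of_nonneg (Real.log_nonneg h), abs_of_nonneg (by linarith)]
    have := Real.log_le_sub_one_of_pos hu
    linarith
  · rw [abs_of_nonpos (Real.log_nonpos hu.le h), abs_of_nonpos (by linarith)]
    have := Real.one_sub_inv_le_log_of_pos hu
    have h3 : u⁻¹ - 1 ≤ 2 * (1 - u) := by
      rw [show u⁻¹ - 1 = (1 - u) / u by field_simp, div_le_iff₀ hu]
      nlinarith
    linarith

/-- A linear form `S` in powers of `u`, with `l = |log u|`, that is known precisely enough cannot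
be close to a rational number with a small denominator. -/
theorem not_exists_int_of_bounds {A B X S δ P l : ℝ} {q : ℕ} {T : ℤ} (hA : 1 ≤ A) (hX : 1 ≤ X)
    (hB : 10 ^ 60 * A ^ 2 * X ^ 24 ≤ B) (hq : 4 ≤ q)
    (hP : P ≤ B ^ (11 * q + 1) * 5 ^ (12 * q)) (hP0 : 0 < P) (hT : (T : ℝ) = P * (S + δ))
    (hδ : |δ| * B ^ (13 * q) ≤ 12 * q * A ^ q * (10 * 10 ^ (32 * q) * X))
    (hl1 : 1 ≤ 4 * l * B) (hl2 : l * B ≤ 4 * X)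
    (hS1 : l ^ (12 * q - 1) ≤ A ^ q * |S|) (hS2 : |S| ≤ A ^ q * l ^ (12 * q - 1)) : False := by
  have hX24 : X ≤ X ^ 24 := le_self_pow₀ hX (by norm_num)
  have hB60 : 10 ^ 60 ≤ B := by
    refine le_trans ?_ hB
    have h1 : (1 : ℝ) ≤ A ^ 2 := one_le_pow₀ hA
    have h2 : (1 : ℝ) ≤ X ^ 24 := one_le_pow₀ hX
    calc (10 : ℝ) ^ 60 = 10 ^ 60 * 1 * 1 := by ring
      _ ≤ _ := by gcongr
  have hB0 : 0 < B := lt_of_lt_of_le (by norm_num) hB60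
  have hl0 : 0 < l := by
    by_contra! h
    nlinarith
  have hq1 : 12 * q - 1 + 1 = 12 * q := by omega
  have hBq : (10 ^ 60 * A ^ 2 * X ^ 24) ^ q ≤ B ^ q := pow_le_pow_left₀ (by positivity) hB _
  -- the error term is smaller than the main term
  have hδS : |δ| < |S| := by
    have h1 : 1 ≤ (4 * B) ^ (12 * q) * (A ^ q * |S|) := by
      calc (1 : ℝ) ≤ (4 * l * B) ^ (12 * q - 1) := one_le_pow₀ hl1
        _ = (4 * B) ^ (12 * q - 1) * l ^ (12 * q - 1) := by rw [← mul_pow]; ring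
        _ ≤ (4 * B) ^ (12 * q) * (A ^ q * |S|) :=
          mul_le_mul (pow_le_pow_right₀ (by linarith) (by omega)) hS1 (by positivity)
            (by positivity)
    have h2 : 12 * (q : ℝ) * A ^ q * (10 * 10 ^ (32 * q) * X) * (4 ^ (12 * q) * A ^ q) < B ^ q := by
      have hq120 : 120 * (q : ℝ) < 10 ^ (4 * q) := by
        have h3 : (q : ℝ) < 2 ^ q := by exact_mod_cast Nat.lt_two_pow_self
        have h4 : (120 : ℝ) ≤ 5000 ^ q :=
          le_trans (by norm_num) (le_self_pow₀ (by norm_num : (1 : ℝ) ≤ 5000) (by omega))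
        calc 120 * (q : ℝ) < 120 * 2 ^ q := by linarith
          _ ≤ 5000 ^ q * 2 ^ q := by gcongr
          _ = _ := by rw [← mul_pow, pow_mul]; norm_num
      calc 12 * (q : ℝ) * A ^ q * (10 * 10 ^ (32 * q) * X) * (4 ^ (12 * q) * A ^ q)
          = (120 * q) * (10 ^ (32 * q) * X * 4 ^ (12 * q) * (A ^ q * A ^ q)) := by ring
        _ < 10 ^ (4 * q) * (10 ^ (32 * q) * X * 4 ^ (12 * q) * (A ^ q * A ^ q)) := by
          gcongr
        _ ≤ 10 ^ (4 * q) * (10 ^ (32 * q) * (X ^ 24) ^ q * 4 ^ (12 * q) * (A ^ q * A ^ q)) := by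
          gcongr
          exact hX24.trans (le_self_pow₀ (one_le_pow₀ hX) (by omega))
        _ = (10 ^ 4 * (10 ^ 32 * X ^ 24 * 4 ^ 12 * (A * A))) ^ q := by
          simp only [mul_pow, pow_mul]
        _ ≤ (10 ^ 60 * A ^ 2 * X ^ 24) ^ q := by
          refine pow_le_pow_left₀ (by positivity) ?_ _
          have : 0 ≤ A ^ 2 * X ^ 24 := by positivity
          nlinarith
        _ ≤ _ := hBq
    have h5 : B ^ (13 * q) = B ^ (12 * q) * B ^ q := by rw [← pow_add]; congr 1; ring
    by_contra! hle
    have h6 : 1 ≤ (4 * B) ^ (12 * q) * (A ^ q * |δ|) := h1.trans (by gcongr)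
    have h7 : B ^ q ≤ 4 ^ (12 * q) * A ^ q * (|δ| * B ^ (13 * q)) := by
      calc B ^ q = B ^ q * 1 := (mul_one _).symm
        _ ≤ B ^ q * ((4 * B) ^ (12 * q) * (A ^ q * |δ|)) := by gcongr
        _ = _ := by rw [h5, mul_pow]; ring
    have h8 : 4 ^ (12 * q) * A ^ q * (|δ| * B ^ (13 * q)) ≤
        4 ^ (12 * q) * A ^ q * (12 * q * A ^ q * (10 * 10 ^ (32 * q) * X)) := by gcongr
    linarith
  have hT0 : T ≠ 0 := by
    rintro rfl
    rw [Int.cast_zero, eq_comm, mul_eq_zero] at hT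
    rcases hT with h | h
    · exact hP0.ne' h
    · rw [eq_neg_of_add_eq_zero_left h, abs_neg] at hδS
      exact lt_irrefl _ hδS
  have hT1 : (1 : ℝ) ≤ |(T : ℝ)| := by exact_mod_cast Int.one_le_abs hT0
  -- but the integer is smaller than one
  set K : ℝ := A * 20 ^ 12 with hK
  have h9 : |(T : ℝ)| * B ^ (q - 2) ≤ 2 * K ^ q * X ^ (12 * q) := by
    have h10 : |S + δ| ≤ 2 * |S| := (abs_add_le _ _).trans (by linarith)
    have h11 : l ^ (12 * q - 1) * B ^ (12 * q - 1) ≤ 4 ^ (12 * q) * X ^ (12 * q) := by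
      rw [← mul_pow, ← mul_pow]
      exact (pow_le_pow_left₀ (by positivity) hl2 _).trans
        (pow_le_pow_right₀ (by linarith) (by omega))
    calc |(T : ℝ)| * B ^ (q - 2) = P * |S + δ| * B ^ (q - 2) := by
          rw [hT, abs_mul, abs_of_pos hP0]
      _ ≤ (B ^ (11 * q + 1) * 5 ^ (12 * q)) * (2 * (A ^ q * l ^ (12 * q - 1))) * B ^ (q - 2) := by
          gcongr
          linarith
      _ = 2 * A ^ q * 5 ^ (12 * q) * (l ^ (12 * q - 1) * B ^ (12 * q - 1)) := by
          rw [show 12 * q - 1 = (11 * q + 1) + (q - 2) by omega, pow_add B]; ring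
      _ ≤ 2 * A ^ q * 5 ^ (12 * q) * (4 ^ (12 * q) * X ^ (12 * q)) := by gcongr
      _ = _ := by
          rw [hK, mul_pow, ← pow_mul, show (20 : ℝ) = 5 * 4 by norm_num, mul_pow]; ring
  have h12 : 2 * K ^ q * X ^ (12 * q) < B ^ (q - 2) := by
    refine lt_of_pow_lt_pow_left₀ 2 (by positivity) ?_
    calc (2 * K ^ q * X ^ (12 * q)) ^ 2 = 4 * (K ^ 2 * X ^ 24) ^ q := by
          rw [mul_pow (K ^ 2), ← pow_mul, ← pow_mul, mul_pow, mul_pow, ← pow_mul, ← pow_mul]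
          ring
      _ < 10 ^ q * (K ^ 2 * X ^ 24) ^ q := by
          have : (4 : ℝ) < 10 ^ q :=
            lt_of_lt_of_le (by norm_num) (le_self_pow₀ (by norm_num : (1 : ℝ) ≤ 10) (by omega))
          gcongr
      _ = (10 * (A ^ 2 * 20 ^ 24 * X ^ 24)) ^ q := by rw [← mul_pow, hK]; ring
      _ ≤ (10 ^ 60 * A ^ 2 * X ^ 24) ^ q := by
          refine pow_le_pow_left₀ (by positivity) ?_ _
          have : 0 ≤ A ^ 2 * X ^ 24 := by positivity
          nlinarith
      _ ≤ B ^ q := hBq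
      _ ≤ (B ^ (q - 2)) ^ 2 := by
          rw [← pow_mul]; exact pow_le_pow_right₀ (by linarith) (by omega)
  have h13 : B ^ (q - 2) ≤ |(T : ℝ)| * B ^ (q - 2) :=
    le_mul_of_one_le_left (by positivity) hT1
  linarith

open Real goldenRatio in
theorem ratio_mem_of_large {a m : ℕ} {X : ℝ} (hX : 1 ≤ X) (hm : 4 * X ≤ 2 ^ m)
    (h : |(Nat.fib a : ℝ) - 2 ^ m| ≤ X) :
    1 / 2 ≤ φ ^ a / (√5 * 2 ^ m) ∧ φ ^ a / (√5 * 2 ^ m) ≤ 2 := by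
  have h1 := (abs_ratio_sub_one_bounds hX h).1
  have h2 : |φ ^ a / (√5 * 2 ^ m) - 1| ≤ 1 / 2 := by
    by_contra! hlt
    have := abs_nonneg (φ ^ a / (√5 * 2 ^ m) - 1)
    nlinarith
  constructor <;> linarith [(abs_le.1 h2).1, (abs_le.1 h2).2]

open Real goldenRatio in
/-- Two solutions of `|F_n - 2 ^ m| ≤ X` with `2 ^ m` large compared to `X`
cannot be too far from each other. -/
theorem exists_no_far_solution : ∃ C : ℝ, 10 ^ 60 ≤ C ∧ ∀ (X : ℝ) (a b m₁ m₂ : ℕ), 1 ≤ X →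
    |(Nat.fib a : ℝ) - 2 ^ m₁| ≤ X → Nat.fib a ≠ 2 ^ m₁ → |(Nat.fib b : ℝ) - 2 ^ m₂| ≤ X →
    C * X ^ 24 ≤ 2 ^ m₁ → m₂ < 52 * m₁ := by
  obtain ⟨A, hA, hc⟩ := exists_int_coeff_sum_zpow_bounds
  refine ⟨10 ^ 60 * A ^ 2, le_mul_of_one_le_right (by positivity) (one_le_pow₀ hA), ?_⟩
  intro X a b m₁ m₂ hX ha hne hb hB
  by_contra! hm
  have hX24 : X ≤ X ^ 24 := le_self_pow₀ hX (by norm_num)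
  have hXX : 10 ^ 60 * X ≤ 2 ^ m₁ := by
    refine le_trans ?_ hB
    have h1 : (1 : ℝ) ≤ A ^ 2 := one_le_pow₀ hA
    calc (10 : ℝ) ^ 60 * X = 10 ^ 60 * 1 * X := by ring
      _ ≤ _ := by gcongr
  have hm0 : 0 < m₁ := by
    by_contra! h0
    have : m₁ = 0 := by omega
    subst this
    norm_num at hXX
    linarith
  have h12 : (2 : ℝ) ^ m₁ ≤ 2 ^ m₂ := pow_le_pow_right₀ (by norm_num) (by omega)
  have hu := ratio_mem_of_large hX (by linarith) ha
  have hv := ratio_mem_of_large hX (by linarith) hb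
  have hu' := abs_ratio_sub_one_bounds hX ha
  have hv' := (abs_ratio_sub_one_bounds hX hb).1
  obtain ⟨R, s, q, hs, hmR, hq, hqR, hRq⟩ : ∃ R s q : ℕ, s ≤ m₁ ∧ m₂ = m₁ * R + s ∧ 4 ≤ q ∧
      13 * q ≤ R ∧ R ≤ 16 * q := by
    have hR : 52 ≤ m₂ / m₁ := (Nat.le_div_iff_mul_le hm0).2 hm
    refine ⟨m₂ / m₁, m₂ % m₁, m₂ / m₁ / 13, (Nat.mod_lt _ hm0).le,
      (Nat.div_add_mod _ _).symm, ?_, ?_, ?_⟩ <;> omega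
  subst hmR
  set u := φ ^ a / (√5 * 2 ^ m₁) with hudef
  set v := φ ^ b / (√5 * 2 ^ (m₁ * R + s)) with hvdef
  have hua : φ ^ a = u * (√5 * 2 ^ m₁) := by rw [hudef]; field_simp
  have hvb : φ ^ b = v * (√5 * 2 ^ (m₁ * R + s)) := by rw [hvdef]; field_simp
  obtain ⟨c, hcA, hcS⟩ := hc q R (by omega) hqR hRq
  obtain ⟨hS1, hS2⟩ := hcS u hu.1 hu.2
  have key : ∀ p : ℕ × ℕ, ∃ I : ℤ, ∃ η : ℝ, p ∈ Finset.range (4 * q) ×ˢ Finset.range 3 →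
      (I : ℝ) = 2 ^ ((11 * q + 1) * m₁) * √5 ^ (12 * q) *
        (u ^ ((7 * q + p.1 : ℤ) - p.2 * R) + η) ∧
      |η| * (2 ^ m₁) ^ (13 * q) ≤ 10 * 10 ^ (32 * q) * X := by
    intro p
    by_cases hp : p ∈ Finset.range (4 * q) ×ˢ Finset.range 3
    · obtain ⟨hp1, hp2⟩ := Finset.mem_product.1 hp
      obtain ⟨I, η, h⟩ := exists_int_eq_zpow_add hX (by linarith) (by omega : 1 ≤ q) hqR hRq hs
        (Finset.mem_range.1 hp1) (Finset.mem_range.1 hp2) hu.1 hu.2 hv.1 hv.2 hua hvb hv'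
      exact ⟨I, η, fun _ => h⟩
    · exact ⟨0, 0, fun h => absurd h hp⟩
  choose I η hIη using key
  have hlog := half_abs_sub_one_le_abs_log hu.1 hu.2
  have hlog' := abs_log_le_two_mul_abs_sub_one hu.1
  have hpos : (0 : ℝ) < 2 ^ m₁ := by positivity
  refine not_exists_int_of_bounds (q := q) (l := |Real.log u|)
    (P := 2 ^ ((11 * q + 1) * m₁) * √5 ^ (12 * q))
    (T := ∑ p ∈ Finset.range (4 * q) ×ˢ Finset.range 3, c p * I p)
    (S := ∑ p ∈ Finset.range (4 * q) ×ˢ Finset.range 3, (c p : ℝ) * u ^ ((7 * q + p.1 : ℤ) - p.2 * R))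
    (δ := ∑ p ∈ Finset.range (4 * q) ×ˢ Finset.range 3, (c p : ℝ) * η p)
    hA hX hB hq ?_ (by positivity) ?_ ?_ ?_ ?_ hS1 hS2
  · rw [mul_comm _ m₁, pow_mul]
    gcongr
    exact Real.sqrt_le_self_iff.2 (Or.inr (by norm_num))
  · push_cast
    rw [← Finset.sum_add_distrib, Finset.mul_sum]
    refine Finset.sum_congr rfl fun p hp => ?_
    rw [(hIη p hp).1]; ring
  · calc |∑ p ∈ Finset.range (4 * q) ×ˢ Finset.range 3, (c p : ℝ) * η p| * (2 ^ m₁) ^ (13 * q)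
        ≤ (∑ p ∈ Finset.range (4 * q) ×ˢ Finset.range 3, |(c p : ℝ) * η p|) *
          (2 ^ m₁) ^ (13 * q) :=
          mul_le_mul_of_nonneg_right (Finset.abs_sum_le_sum_abs _ _) (by positivity)
      _ = ∑ p ∈ Finset.range (4 * q) ×ˢ Finset.range 3,
          |(c p : ℝ)| * (|η p| * (2 ^ m₁) ^ (13 * q)) := by
          rw [Finset.sum_mul]
          exact Finset.sum_congr rfl fun p _ => by rw [abs_mul]; ring
      _ ≤ ∑ p ∈ Finset.range (4 * q) ×ˢ Finset.range 3,
          A ^ q * (10 * 10 ^ (32 * q) * X) :=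
          Finset.sum_le_sum fun p hp =>
            mul_le_mul (hcA p hp) (hIη p hp).2 (by positivity) (by positivity)
      _ = _ := by
          rw [Finset.sum_const, Finset.card_product, Finset.card_range, Finset.card_range,
            nsmul_eq_mul]
          push_cast; ring
  · have := hu'.2 hne
    nlinarith
  · nlinarith [hu'.1]

/-- No power of two from `16` on is a Fibonacci number: `16 ∣ F_a` implies `3 ∣ F_a`. -/
theorem fib_ne_two_pow (a : ℕ) {m : ℕ} (hm : 4 ≤ m) : Nat.fib a ≠ 2 ^ m := by
  have hper : ∀ k r : ℕ, Nat.fib (24 * k + r) % 48 = Nat.fib r % 48 := by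
    intro k
    induction k with
    | zero => simp
    | succ k ih =>
      intro r
      have h := Nat.fib_add (24 * k + r) 23
      have h23 : Nat.fib 23 = 28657 := by norm_num
      have h24 : Nat.fib (23 + 1) = 46368 := by norm_num
      rw [h23, h24] at h
      rw [show 24 * (k + 1) + r = 24 * k + r + 23 + 1 by ring, h, ← ih r]
      omega
  have hr : ∀ r < 24, Nat.fib r % 16 = 0 → Nat.fib r % 3 = 0 := by decide
  intro h
  have h1 := hper (a / 24) (a % 24)
  rw [Nat.div_add_mod] at h1
  have h2 := hr (a % 24) (Nat.mod_lt _ (by norm_num))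
  have h16 : Nat.fib a % 16 = 0 := by
    rw [h]; exact Nat.mod_eq_zero_of_dvd (pow_dvd_pow 2 hm)
  have h3 : 3 ∣ 2 ^ m := by rw [← h]; omega
  have := (Nat.prime_dvd_prime_iff_eq Nat.prime_three Nat.prime_two).1
    (Nat.prime_three.dvd_of_dvd_pow h3)
  omega

open Real goldenRatio in
/-- Lucas numbers are integers not divisible by `8`. -/
theorem exists_int_lucas (a : ℕ) : ∃ t : ℤ, (t : ℝ) = φ ^ a + ψ ^ a ∧ ¬ 8 ∣ t := by
  have hper : ∀ k r : ℕ, Nat.fib (12 * k + r) % 8 = Nat.fib r % 8 := by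
    intro k
    induction k with
    | zero => simp
    | succ k ih =>
      intro r
      have h := Nat.fib_add (12 * k + r) 11
      have h11 : Nat.fib 11 = 89 := by norm_num
      have h12 : Nat.fib (11 + 1) = 144 := by norm_num
      rw [h11, h12] at h
      rw [show 12 * (k + 1) + r = 12 * k + r + 11 + 1 by ring, h, ← ih r]
      omega
  have hr : ∀ r < 12, (2 * Nat.fib (r + 1) + 7 * Nat.fib r) % 8 ≠ 0 := by decide
  refine ⟨2 * Nat.fib (a + 1) - Nat.fib a, ?_, ?_⟩
  · push_cast
    have h1 := fib_succ_sub_goldenConj_mul_fib a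
    have h2 := fib_succ_sub_goldenRatio_mul_fib a
    rw [← h1, ← h2]
    linear_combination (Nat.fib a : ℝ) * goldenRatio_add_goldenConj
  · have h1 := hper (a / 12) (a % 12)
    have h2 := hper (a / 12) (a % 12 + 1)
    rw [← add_assoc] at h2
    rw [Nat.div_add_mod] at h1 h2
    have h3 := hr (a % 12) (Nat.mod_lt _ (by norm_num))
    omega

open Real goldenRatio in
/-- Two solutions of `|F_n - 2 ^ m| ≤ X` with `2 ^ m` large compared to `X`
cannot be too close to each other. -/
theorem three_mul_lt_two_mul_of_solutions {X : ℝ} {n₁ n₂ m₁ m₂ : ℕ} (hX : 1 ≤ X)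
    (h₁ : |(Nat.fib n₁ : ℝ) - 2 ^ m₁| ≤ X) (h₂ : |(Nat.fib n₂ : ℝ) - 2 ^ m₂| ≤ X)
    (hm : m₁ < m₂) (hB : 10 ^ 6 * X ^ 2 ≤ 2 ^ m₁) : 3 * m₁ < 2 * m₂ := by
  by_contra! hle
  obtain ⟨b, rfl⟩ := Nat.exists_eq_add_of_lt hm
  rw [add_assoc] at *
  generalize hb : b + 1 = b' at *
  have hXX : X ≤ X ^ 2 := le_self_pow₀ hX (by norm_num)
  have h12 : (2 : ℝ) ^ m₁ ≤ 2 ^ (m₁ + b') := pow_le_pow_right₀ (by norm_num) (by omega)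
  have hu := ratio_mem_of_large hX (by linarith) h₁
  have hu1 := (abs_ratio_sub_one_bounds hX h₁).1
  have hv1 := (abs_ratio_sub_one_bounds hX h₂).1
  set u := φ ^ n₁ / (√5 * 2 ^ m₁) with hudef
  set v := φ ^ n₂ / (√5 * 2 ^ (m₁ + b')) with hvdef
  have hpos : (0 : ℝ) < 2 ^ m₁ := by positivity
  have hua : φ ^ n₁ = u * (√5 * 2 ^ m₁) := by rw [hudef]; field_simp
  have hvb : φ ^ n₂ = v * (√5 * 2 ^ (m₁ + b')) := by rw [hvdef]; field_simp
  have hv1' : |v - 1| * 2 ^ m₁ ≤ 2 * X :=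
    (mul_le_mul_of_nonneg_left h12 (abs_nonneg _)).trans hv1
  have huv : |v - u| * 2 ^ m₁ ≤ 4 * X := by
    have : |v - u| ≤ |v - 1| + |u - 1| := by
      rw [show v - u = (v - 1) - (u - 1) by ring]; exact abs_sub _ _
    nlinarith
  have hb2 : (2 : ℝ) ≤ 2 ^ b' := by
    rw [← hb]; exact le_self_pow₀ (by norm_num) (by omega)
  have hvu : 3 / 4 * u ≤ v := by
    have h3 : |v - u| ≤ 1 / 8 := by
      by_contra! hlt
      nlinarith
    linarith [(abs_le.1 h3).1]
  have hlt : n₁ < n₂ := by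
    refine (pow_lt_pow_iff_right₀ one_lt_goldenRatio).1 ?_
    rw [hua, hvb, pow_add]
    have h3 : u < v * 2 ^ b' := by nlinarith
    have h4 : 0 < √5 * 2 ^ m₁ := by positivity
    nlinarith [mul_lt_mul_of_pos_right h3 h4]
  obtain ⟨a, ha⟩ := Nat.exists_eq_add_of_le hlt.le
  have ha0 : a ≠ 0 := by omega
  have hφa : φ ^ a * u = 2 ^ b' * v := by
    rw [ha, pow_add, hua, pow_add] at hvb
    have h4 : √5 * 2 ^ m₁ ≠ 0 := by positivity
    exact mul_left_cancel₀ h4 (by linear_combination hvb)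
  have hdiff : |φ ^ a - 2 ^ b'| * 2 ^ m₁ ≤ 2 ^ b' * (8 * X) := by
    have h5 : |φ ^ a - 2 ^ b'| * u = 2 ^ b' * |v - u| := by
      rw [← abs_of_pos (by linarith : 0 < u), ← abs_mul, sub_mul, hφa, ← mul_sub, abs_mul,
        abs_of_pos (by positivity : (0 : ℝ) < 2 ^ b'), abs_of_pos (by linarith : 0 < u)]
    have h6 : |φ ^ a - 2 ^ b'| ≤ 2 ^ b' * (2 * |v - u|) := by
      nlinarith [abs_nonneg (φ ^ a - 2 ^ b')]
    calc |φ ^ a - 2 ^ b'| * 2 ^ m₁ ≤ (2 ^ b' * (2 * |v - u|)) * 2 ^ m₁ :=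
          mul_le_mul_of_nonneg_right h6 hpos.le
      _ = 2 ^ b' * (2 * (|v - u| * 2 ^ m₁)) := by ring
      _ ≤ _ := mul_le_mul_of_nonneg_left (by linarith) (by positivity)
  have hsmall : 2 ^ b' * (8 * X) ≤ 1 / 100 * 2 ^ m₁ := by
    refine (pow_le_pow_iff_left₀ (by positivity) (by positivity) two_ne_zero).1 ?_
    have h7 : ((2 : ℝ) ^ b') ^ 2 ≤ 2 ^ m₁ := by
      rw [← pow_mul]; exact pow_le_pow_right₀ (by norm_num) (by omega)
    calc (2 ^ b' * (8 * X)) ^ 2 = (2 ^ b') ^ 2 * (64 * X ^ 2) := by ring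
      _ ≤ 2 ^ m₁ * (64 * X ^ 2) := mul_le_mul_of_nonneg_right h7 (by positivity)
      _ ≤ 2 ^ m₁ * (1 / 100 ^ 2 * 2 ^ m₁) :=
        mul_le_mul_of_nonneg_left (by nlinarith) (by positivity)
      _ = _ := by ring
  have hdiff2 : |φ ^ a - 2 ^ b'| ≤ 1 / 100 :=
    le_of_mul_le_mul_right (hdiff.trans hsmall) hpos
  have hψφ : |ψ ^ a| * φ ^ a = 1 := by
    rw [abs_pow, ← mul_pow, abs_of_neg goldenConj_neg, neg_mul, goldenConj_mul_goldenRatio]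
    simp
  have hd := abs_le.1 hdiff2
  have hψ : |ψ ^ a| ≤ 9 / 10 := by
    nlinarith [abs_nonneg (ψ ^ a)]
  obtain ⟨t, ht, ht8⟩ := exists_int_lucas a
  have htb : t = 2 ^ b' := by
    have h7 : |((t - 2 ^ b' : ℤ) : ℝ)| < 1 := by
      push_cast
      rw [ht, show φ ^ a + ψ ^ a - 2 ^ b' = (φ ^ a - 2 ^ b') + ψ ^ a by ring]
      exact (abs_add_le _ _).trans_lt (by linarith)
    have h8 : |t - 2 ^ b'| < 1 := by exact_mod_cast h7
    have := Int.abs_lt_one_iff.1 h8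
    omega
  have hb3 : b' < 3 := by
    by_contra! h
    exact ht8 (htb ▸ pow_dvd_pow 2 h)
  have hb4 : (2 : ℝ) ^ b' ≤ 4 := by
    calc (2 : ℝ) ^ b' ≤ 2 ^ 2 := pow_le_pow_right₀ (by norm_num) (by omega)
      _ = 4 := by norm_num
  have hψ2 : |ψ ^ a| ≤ 1 / 100 := by
    have h9 : ψ ^ a = -(φ ^ a - 2 ^ b') := by
      have : (t : ℝ) = 2 ^ b' := by exact_mod_cast htb
      linarith
    rw [h9, abs_neg]; exact hdiff2
  nlinarith [abs_nonneg (ψ ^ a)]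

theorem fib_le_two_mul_fib_sub_one {n : ℕ} (hn : 2 ≤ n) : Nat.fib n ≤ 2 * Nat.fib (n - 1) := by
  obtain ⟨k, rfl⟩ := Nat.exists_eq_add_of_le' hn
  rw [Nat.fib_add_two, show k + 2 - 1 = k + 1 by omega]
  have : Nat.fib k ≤ Nat.fib (k + 1) := Nat.fib_le_fib_succ
  omega

theorem two_mul_fib_le (n : ℕ) : 2 * Nat.fib n ≤ Nat.fib (n + 2) := by
  rw [Nat.fib_add_two]
  have : Nat.fib n ≤ Nat.fib (n + 1) := Nat.fib_le_fib_succ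
  omega

theorem fib_le_three_mul_fib_sub_two {n : ℕ} (hn : 3 ≤ n) :
    Nat.fib n ≤ 3 * Nat.fib (n - 2) := by
  obtain ⟨k, rfl⟩ := Nat.exists_eq_add_of_le' hn
  rw [show k + 3 - 2 = k + 1 by omega, show k + 3 = k + 1 + 2 by omega, Nat.fib_add_two,
    Nat.fib_add_two]
  have : Nat.fib k ≤ Nat.fib (k + 1) := Nat.fib_le_fib_succ
  omega

/-- For `2 ^ m` large compared to `X`, at most one Fibonacci number is within `X` of `2 ^ m`. -/
theorem fib_eq_fib_of_near {X : ℝ} {n n' m : ℕ} (hX : 1 ≤ X) (hm : 32 * X < 2 ^ m)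
    (h : |(Nat.fib n : ℝ) - 2 ^ m| ≤ X) (h' : |(Nat.fib n' : ℝ) - 2 ^ m| ≤ X) :
    Nat.fib n = Nat.fib n' := by
  wlog hlt : n < n' generalizing n n' with H
  · rcases eq_or_lt_of_le (not_lt.1 hlt) with h0 | h0
    · rw [h0]
    · exact (H h' h h0).symm
  have h1 := abs_le.1 h
  have h2 := abs_le.1 h'
  have hn : 2 ≤ n := by
    by_contra! h3
    have h4 : Nat.fib n ≤ 1 := by interval_cases n <;> simp
    have h5 : (Nat.fib n : ℝ) ≤ 1 := by exact_mod_cast h4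
    linarith
  have h3 : Nat.fib (n + 1) ≤ Nat.fib n' := Nat.fib_mono hlt
  have h4 := Nat.fib_add_one (by omega : n ≠ 0)
  have h5 := fib_le_two_mul_fib_sub_one hn
  have h6 : (3 : ℝ) * Nat.fib n ≤ 2 * Nat.fib n' := by exact_mod_cast (by omega)
  linarith

/-- A set of naturals whose gaps are large and whose extent is bounded is small. -/
theorem card_le_of_gaps {T : Finset ℕ} (h1 : ∀ m ∈ T, ∀ m' ∈ T, m < m' → 3 * m < 2 * m')
    (h2 : ∀ m ∈ T, ∀ m' ∈ T, m' < 52 * m) : T.card ≤ 13 := by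
  rcases T.eq_empty_or_nonempty with rfl | hne
  · simp
  set m₀ := T.min' hne
  have hm₀ : m₀ ∈ T := T.min'_mem hne
  have hpos : ∀ m ∈ T, 0 < m := fun m hm => by have := h2 m hm m hm; omega
  have hstrict : ∀ m ∈ T, ∀ m' ∈ T, m < m' → Nat.log 2 (m ^ 2) < Nat.log 2 (m' ^ 2) := by
    intro m hm m' hm' hlt
    have h3 := h1 m hm m' hm' hlt
    have h0 := hpos m hm
    have h4 : m ^ 2 * 2 ≤ m' ^ 2 := by nlinarith
    have h5 := Nat.log_mono_right (b := 2) h4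
    rw [Nat.log_mul_base (by norm_num) (by positivity)] at h5
    omega
  calc T.card ≤ (Finset.Icc (Nat.log 2 (m₀ ^ 2)) (Nat.log 2 (m₀ ^ 2) + 12)).card := by
        refine Finset.card_le_card_of_injOn (fun m => Nat.log 2 (m ^ 2)) ?_ ?_
        · intro m hm
          have h3 := h2 m₀ hm₀ m hm
          have h4 : m₀ ≤ m := T.min'_le m hm
          have h0 := hpos m₀ hm₀
          refine Finset.mem_coe.2 (Finset.mem_Icc.2 ⟨Nat.log_mono_right (by gcongr), ?_⟩)
          have h5 : m ^ 2 ≤ m₀ ^ 2 * 2 ^ 12 := by nlinarith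
          have h6 := Nat.log_mono_right (b := 2) h5
          have h7 : ∀ k : ℕ, Nat.log 2 (m₀ ^ 2 * 2 ^ k) = Nat.log 2 (m₀ ^ 2) + k := by
            intro k
            induction k with
            | zero => simp
            | succ k ih =>
              rw [pow_succ 2 k, ← mul_assoc, Nat.log_mul_base (by norm_num) (by positivity), ih,
                add_assoc]
          rwa [h7] at h6
        · intro m hm m' hm' heq
          rcases lt_trichotomy m m' with h | h | h
          · exact absurd heq (hstrict m hm m' hm' h).ne
          · exact h
          · exact absurd heq (hstrict m' hm' m hm h).ne'
    _ = 13 := by rw [Nat.card_Icc]; omega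

/-- Differences `F_n - 2 ^ m` determine `(n, m)` as soon as `F_n` and `2 ^ m` are not of
comparable size. -/
theorem eq_of_fib_sub_two_pow_eq {n n' m m' : ℕ} (hn : 2 ≤ n) (hn' : 2 ≤ n')
    (h : ¬ (2 ^ m ≤ 2 * Nat.fib n ∧ Nat.fib n ≤ 3 * 2 ^ m))
    (h' : ¬ (2 ^ m' ≤ 2 * Nat.fib n' ∧ Nat.fib n' ≤ 3 * 2 ^ m'))
    (heq : (Nat.fib n : ℤ) - 2 ^ m = Nat.fib n' - 2 ^ m') : n = n' ∧ m = m' := by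
  wlog hlt : n' < n generalizing n n' m m' with H
  · rcases eq_or_lt_of_le (not_lt.1 hlt) with h0 | h0
    · subst h0
      refine ⟨rfl, Nat.pow_right_injective le_rfl ?_⟩
      have : (2 : ℤ) ^ m = 2 ^ m' := by linarith
      exact_mod_cast this
    · obtain ⟨h1, h2⟩ := H hn' hn h' h heq.symm h0
      exact ⟨h1.symm, h2.symm⟩
  exfalso
  have heq' : Nat.fib n + 2 ^ m' = Nat.fib n' + 2 ^ m := by
    have : (Nat.fib n : ℤ) + 2 ^ m' = Nat.fib n' + 2 ^ m := by linarith
    exact_mod_cast this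
  have h1 : Nat.fib n' < Nat.fib n := (Nat.fib_lt_fib hn').2 hlt
  have h2 : m' < m := by
    have h2 : 2 ^ m' < 2 ^ m := by omega
    exact (Nat.pow_lt_pow_iff_right (by norm_num)).1 h2
  have h3 : 2 * 2 ^ m' ≤ 2 ^ m := by
    rw [← pow_succ']; exact Nat.pow_le_pow_right (by norm_num) h2
  have h4 : Nat.fib n' ≤ Nat.fib (n - 1) := Nat.fib_mono (by omega)
  have h5 := fib_le_three_mul_fib_sub_two (by omega : 3 ≤ n)
  have h6 : Nat.fib n = Nat.fib (n - 2) + Nat.fib (n - 1) := by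
    obtain ⟨k, rfl⟩ := Nat.exists_eq_add_of_le' hn
    exact Nat.fib_add_two
  exact h ⟨by omega, by omega⟩

/-- For fixed `m`, the `n` with `F_n` comparable to `2 ^ m` are distinguished by `n % 6`. -/
theorem eq_of_mod_six_eq {n n' m : ℕ} (h : 2 ^ m ≤ 2 * Nat.fib n ∧ Nat.fib n ≤ 3 * 2 ^ m)
    (h' : 2 ^ m ≤ 2 * Nat.fib n' ∧ Nat.fib n' ≤ 3 * 2 ^ m) (hmod : n % 6 = n' % 6) : n = n' := by
  wlog hlt : n < n' generalizing n n' with H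
  · rcases eq_or_lt_of_le (not_lt.1 hlt) with h0 | h0
    · exact h0.symm
    · exact (H h' h hmod.symm h0).symm
  exfalso
  have h1 : Nat.fib (n + 6) ≤ Nat.fib n' := Nat.fib_mono (by omega)
  have h2 := two_mul_fib_le n
  have h3 := two_mul_fib_le (n + 2)
  have h4 := two_mul_fib_le (n + 4)
  have h5 : 0 < 2 ^ m := by positivity
  simp only [add_assoc, Nat.reduceAdd] at h3 h4
  omega

theorem finite_fib_sub_two_pow (x : ℝ) :
    {c : ℤ | (|c| : ℝ) ≤ x ∧ ∃ n m : ℕ, c = (Nat.fib n : ℤ) - 2 ^ m}.Finite := by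
  refine (Set.finite_Icc (-⌈x⌉) ⌈x⌉).subset ?_
  rintro c ⟨hc, -⟩
  have h1 : |c| ≤ ⌈x⌉ := by
    have : ((|c| : ℤ) : ℝ) ≤ ⌈x⌉ := by push_cast; exact hc.trans (Int.le_ceil x)
    exact_mod_cast this
  exact abs_le.1 h1

theorem le_card_fib_sub_two_pow {x : ℝ} {N M : ℕ} (hN : ∀ n < N, (Nat.fib n : ℝ) ≤ x)
    (hM : ∀ m < M, (2 : ℝ) ^ m ≤ x) :
    (N - 8) * M ≤
      Nat.card {c : ℤ | (|c| : ℝ) ≤ x ∧ ∃ n m : ℕ, c = (Nat.fib n : ℤ) - 2 ^ m} := by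
  classical
  rw [Nat.card_coe_set_eq, Set.ncard_eq_toFinset_card _ (finite_fib_sub_two_pow x)]
  set P := Finset.Ico 2 N ×ˢ Finset.range M
  let near : ℕ × ℕ → Prop := fun p => 2 ^ p.2 ≤ 2 * Nat.fib p.1 ∧ Nat.fib p.1 ≤ 3 * 2 ^ p.2
  have hP : P.card = (N - 2) * M := by simp [P]
  have h1 : (P.filter near).card ≤ 6 * M := by
    have : 6 * M = (Finset.range 6 ×ˢ Finset.range M).card := by simp
    rw [this]
    refine Finset.card_le_card_of_injOn (fun p => (p.1 % 6, p.2)) ?_ ?_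
    · intro p hp
      have h2 := (Finset.mem_product.1 (Finset.mem_filter.1 hp).1).2
      exact Finset.mem_coe.2 (Finset.mem_product.2
        ⟨Finset.mem_range.2 (Nat.mod_lt _ (by norm_num)), h2⟩)
    · rintro ⟨n, m⟩ hp ⟨n', m'⟩ hp' heq
      obtain ⟨h2, h3⟩ := Prod.mk.inj heq
      dsimp only at h2 h3
      subst h3
      have := eq_of_mod_six_eq (Finset.mem_filter.1 hp).2 (Finset.mem_filter.1 hp').2 h2
      dsimp only at this
      rw [this]
  have h2 : (P.filter fun p => ¬ near p).card ≤ (finite_fib_sub_two_pow x).toFinset.card := by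
    refine Finset.card_le_card_of_injOn (fun p => (Nat.fib p.1 : ℤ) - 2 ^ p.2) ?_ ?_
    · intro p hp
      obtain ⟨h3, h4⟩ := Finset.mem_product.1 (Finset.mem_filter.1 hp).1
      refine Finset.mem_coe.2 ((Set.Finite.mem_toFinset _).2 ⟨?_, p.1, p.2, rfl⟩)
      have h5 := hN p.1 (Finset.mem_Ico.1 h3).2
      have h6 := hM p.2 (Finset.mem_range.1 h4)
      push_cast
      rw [abs_le]
      have h7 : (0 : ℝ) ≤ Nat.fib p.1 := Nat.cast_nonneg _
      have h8 : (0 : ℝ) < 2 ^ p.2 := by positivity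
      constructor <;> linarith
    · rintro ⟨n, m⟩ hp ⟨n', m'⟩ hp' heq
      obtain ⟨h3, h4⟩ := Finset.mem_filter.1 hp
      obtain ⟨h5, h6⟩ := Finset.mem_filter.1 hp'
      obtain ⟨h7, h8⟩ := eq_of_fib_sub_two_pow_eq
        (Finset.mem_Ico.1 (Finset.mem_product.1 h3).1).1
        (Finset.mem_Ico.1 (Finset.mem_product.1 h5).1).1 h4 h6 heq
      exact Prod.ext h7 h8
  have h3 := Finset.card_filter_add_card_filter_not (s := P) near
  have h4 : (N - 8) * M = (N - 2) * M - 6 * M := by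
    rw [← Nat.sub_mul]; congr 1
  omega

theorem exists_card_fib_sub_two_pow_le : ∃ C : ℝ, 1 ≤ C ∧ ∀ (x : ℝ) (N M K : ℕ), 1 ≤ x →
    (∀ n, (Nat.fib n : ℝ) ≤ 33 * x → n < N) → (∀ m, (2 : ℝ) ^ m ≤ 32 * x → m < M) →
    (∀ m, (2 : ℝ) ^ m < C * x ^ 24 → m < K) →
    Nat.card {c : ℤ | (|c| : ℝ) ≤ x ∧ ∃ n m : ℕ, c = (Nat.fib n : ℤ) - 2 ^ m} ≤
      N * M + K + 13 := by
  classical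
  obtain ⟨C, hC, hfar⟩ := exists_no_far_solution
  refine ⟨C, le_trans (by norm_num) hC, ?_⟩
  intro x N M K hx hN hM hK
  rw [Nat.card_coe_set_eq, Set.ncard_eq_toFinset_card _ (finite_fib_sub_two_pow x)]
  set T := (finite_fib_sub_two_pow x).toFinset with hT
  have key : ∀ c : ℤ, ∃ n m : ℕ, c ∈ T → c = (Nat.fib n : ℤ) - 2 ^ m ∧
      |(Nat.fib n : ℝ) - 2 ^ m| ≤ x := by
    intro c
    by_cases hc : c ∈ T
    · obtain ⟨h1, n, m, h2⟩ := (Set.Finite.mem_toFinset _).1 hc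
      refine ⟨n, m, fun _ => ⟨h2, ?_⟩⟩
      rw [h2] at h1
      push_cast at h1
      exact h1
    · exact ⟨0, 0, fun h => absurd h hc⟩
  choose n m hnm using key
  have hinj : ∀ c ∈ T, ∀ c' ∈ T, 32 * x < 2 ^ m c → m c = m c' → c = c' := by
    intro c hc c' hc' h1 h2
    have h3 := (hnm c' hc').2
    rw [← h2] at h3
    rw [(hnm c hc).1, (hnm c' hc').1, ← h2, fib_eq_fib_of_near hx h1 (hnm c hc).2 h3]
  have h1 : (T.filter fun c => (2 : ℝ) ^ m c ≤ 32 * x).card ≤ N * M := by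
    have : N * M = (Finset.range N ×ˢ Finset.range M).card := by simp
    rw [this]
    refine Finset.card_le_card_of_injOn (fun c => (n c, m c)) ?_ ?_
    · intro c hc
      obtain ⟨h2, h3⟩ := Finset.mem_filter.1 hc
      refine Finset.mem_coe.2 (Finset.mem_product.2
        ⟨Finset.mem_range.2 (hN _ ?_), Finset.mem_range.2 (hM _ h3)⟩)
      linarith [(abs_le.1 (hnm c h2).2).2]
    · intro c hc c' hc' heq
      obtain ⟨h4, h5⟩ := Prod.mk.inj heq
      rw [(hnm c (Finset.mem_filter.1 hc).1).1, (hnm c' (Finset.mem_filter.1 hc').1).1, h4, h5]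
  have h2 : ((T.filter fun c => ¬ (2 : ℝ) ^ m c ≤ 32 * x).filter
      fun c => (2 : ℝ) ^ m c < C * x ^ 24).card ≤ K := by
    rw [← Finset.card_range K]
    refine Finset.card_le_card_of_injOn m ?_ ?_
    · intro c hc
      exact Finset.mem_coe.2 (Finset.mem_range.2 (hK _ (Finset.mem_filter.1 hc).2))
    · intro c hc c' hc' heq
      obtain ⟨h3, h4⟩ := Finset.mem_filter.1 (Finset.mem_filter.1 hc).1
      exact hinj c h3 c' (Finset.mem_filter.1 (Finset.mem_filter.1 hc').1).1 (not_le.1 h4) heq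
  have h3 : ((T.filter fun c => ¬ (2 : ℝ) ^ m c ≤ 32 * x).filter
      fun c => ¬ (2 : ℝ) ^ m c < C * x ^ 24).card ≤ 13 := by
    set T' := (T.filter fun c => ¬ (2 : ℝ) ^ m c ≤ 32 * x).filter
      fun c => ¬ (2 : ℝ) ^ m c < C * x ^ 24 with hT'
    have hmem : ∀ c ∈ T', c ∈ T ∧ 32 * x < 2 ^ m c ∧ C * x ^ 24 ≤ 2 ^ m c := by
      intro c hc
      obtain ⟨h4, h5⟩ := Finset.mem_filter.1 hc
      obtain ⟨h6, h7⟩ := Finset.mem_filter.1 h4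
      exact ⟨h6, not_le.1 h7, not_lt.1 h5⟩
    have hcard : (T'.image m).card = T'.card := by
      refine Finset.card_image_of_injOn ?_
      intro c hc c' hc' heq
      exact hinj c (hmem c hc).1 c' (hmem c' hc').1 (hmem c hc).2.1 heq
    rw [← hcard]
    refine card_le_of_gaps ?_ ?_
    · simp only [Finset.mem_image, forall_exists_index, and_imp, forall_apply_eq_imp_iff₂]
      intro c hc c' hc' hlt
      refine three_mul_lt_two_mul_of_solutions hx (hnm c (hmem c hc).1).2
        (hnm c' (hmem c' hc').1).2 hlt (le_trans ?_ (hmem c hc).2.2)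
      exact mul_le_mul (le_trans (by norm_num) hC) (pow_le_pow_right₀ hx (by norm_num))
        (by positivity) (by linarith)
    · simp only [Finset.mem_image, forall_exists_index, and_imp, forall_apply_eq_imp_iff₂]
      intro c hc c' hc'
      obtain ⟨h4, h5, h6⟩ := hmem c hc
      refine hfar x (n c) (n c') (m c) (m c') hx (hnm c h4).2 (fib_ne_two_pow _ ?_)
        (hnm c' (hmem c' hc').1).2 h6
      by_contra! hlt
      have h7 : (2 : ℝ) ^ m c ≤ 2 ^ 4 := pow_le_pow_right₀ (by norm_num) hlt.le
      linarith
  have h4 := Finset.card_filter_add_card_filter_not (s := T) (fun c => (2 : ℝ) ^ m c ≤ 32 * x)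
  have h5 := Finset.card_filter_add_card_filter_not
    (s := T.filter fun c => ¬ (2 : ℝ) ^ m c ≤ 32 * x) (fun c => (2 : ℝ) ^ m c < C * x ^ 24)
  omega

theorem tendsto_quadratic_div_atTop {α β : ℝ} (hα : 0 < α) (hβ : 0 < β) (a b c d : ℝ) :
    Tendsto (fun L : ℝ => ((L / α + a) * (L / β + b) + c * L + d) / (L ^ 2 / (α * β)))
      atTop (nhds 1) := by
  have h : Tendsto (fun L : ℝ => (1 + a * α * L⁻¹) * (1 + b * β * L⁻¹) + c * (α * β) * L⁻¹ +
      d * (α * β) * (L⁻¹ * L⁻¹)) atTop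
      (nhds ((1 + a * α * 0) * (1 + b * β * 0) + c * (α * β) * 0 + d * (α * β) * (0 * 0))) := by
    have h0 : Tendsto (fun L : ℝ => L⁻¹) atTop (nhds 0) := tendsto_inv_atTop_zero
    exact ((((h0.const_mul _).const_add _).mul ((h0.const_mul _).const_add _)).add
      (h0.const_mul _)).add ((h0.mul h0).const_mul _)
  simp only [mul_zero, add_zero, mul_one] at h
  refine h.congr' ?_
  filter_upwards [eventually_gt_atTop 0] with L hL
  field_simp

theorem pow_le_iff_le_log_div {g x : ℝ} (hg : 1 < g) (hx : 0 < x) (n : ℕ) :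
    g ^ n ≤ x ↔ (n : ℝ) ≤ Real.log x / Real.log g := by
  rw [le_div_iff₀ (Real.log_pos hg), ← Real.log_pow,
    Real.log_le_log_iff (pow_pos (by linarith) n) hx]

theorem lt_floor_add_one_of_pow_le {g x : ℝ} (hg : 1 < g) (hx : 0 < x) {n : ℕ} (h : g ^ n ≤ x) :
    n < ⌊Real.log x / Real.log g⌋₊ + 1 :=
  Nat.lt_succ_of_le (Nat.le_floor ((pow_le_iff_le_log_div hg hx n).1 h))

open Real goldenRatio in
theorem coe_fib_le_goldenRatio_pow (n : ℕ) : (Nat.fib n : ℝ) ≤ φ ^ n := by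
  have h := fib_succ_sub_goldenConj_mul_fib n
  have h1 : (Nat.fib n : ℝ) ≤ Nat.fib (n + 1) := by exact_mod_cast Nat.fib_le_fib_succ
  have h2 : (0 : ℝ) ≤ Nat.fib n := Nat.cast_nonneg _
  nlinarith [goldenConj_neg]

open Real goldenRatio in
theorem goldenRatio_pow_le_three_mul_fib_add_one (n : ℕ) : φ ^ n ≤ 3 * Nat.fib n + 1 := by
  have h := fib_succ_sub_goldenConj_mul_fib n
  have h' := fib_succ_sub_goldenRatio_mul_fib n
  have h2 : (0 : ℝ) ≤ Nat.fib n := Nat.cast_nonneg _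
  have h3 : |ψ ^ n| ≤ 1 := by
    rw [abs_pow]
    exact pow_le_one₀ (abs_nonneg _)
      (abs_le.2 ⟨neg_one_lt_goldenConj.le, by linarith [goldenConj_neg]⟩)
  have h4 := (abs_le.1 h3).2
  nlinarith [goldenRatio_lt_two, neg_one_lt_goldenConj]

open Real goldenRatio in
theorem tendsto_card_fib_sub_two_pow :
    Tendsto (fun x : ℝ =>
      (Nat.card {c : ℤ | (|c| : ℝ) ≤ x ∧ ∃ n m : ℕ, c = (Nat.fib n : ℤ) - 2 ^ m} : ℝ) /
        (Real.log x ^ 2 / (Real.log φ * Real.log 2))) atTop (nhds 1) := by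
  have hα : 0 < Real.log φ := Real.log_pos one_lt_goldenRatio
  have hβ : 0 < Real.log 2 := Real.log_pos one_lt_two
  obtain ⟨C, hC, hupper⟩ := exists_card_fib_sub_two_pow_le
  have hlog : Tendsto Real.log atTop atTop := Real.tendsto_log_atTop
  refine tendsto_of_tendsto_of_tendsto_of_le_of_le'
    ((tendsto_quadratic_div_atTop hα hβ (-8) 0 0 0).comp hlog)
    ((tendsto_quadratic_div_atTop hα hβ (Real.log 100 / Real.log φ + 1)
      (Real.log 32 / Real.log 2 + 1) (24 / Real.log 2) (Real.log C / Real.log 2 + 14)).comp hlog)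
    ?_ ?_
  · filter_upwards [eventually_ge_atTop 1, hlog.eventually_ge_atTop (8 * Real.log φ)] with x hx hL
    have hL' : 8 ≤ Real.log x / Real.log φ := (le_div_iff₀ hα).2 hL
    have hL0 : 0 ≤ Real.log x := Real.log_nonneg hx
    simp only [Function.comp_apply]
    refine div_le_div_of_nonneg_right ?_ (by positivity)
    have h := le_card_fib_sub_two_pow (x := x) (N := ⌊Real.log x / Real.log φ⌋₊ + 1)
      (M := ⌊Real.log x / Real.log 2⌋₊ + 1) ?_ ?_
    · have hN : Real.log x / Real.log φ ≤ ((⌊Real.log x / Real.log φ⌋₊ + 1 : ℕ) : ℝ) := by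
        push_cast; exact (Nat.lt_floor_add_one _).le
      have hM : Real.log x / Real.log 2 ≤ ((⌊Real.log x / Real.log 2⌋₊ + 1 : ℕ) : ℝ) := by
        push_cast; exact (Nat.lt_floor_add_one _).le
      generalize ⌊Real.log x / Real.log φ⌋₊ + 1 = N at *
      generalize ⌊Real.log x / Real.log 2⌋₊ + 1 = M at *
      have hN8 : 8 ≤ N := by exact_mod_cast hL'.trans hN
      have h' : (((N - 8) * M : ℕ) : ℝ) ≤ _ := Nat.cast_le.2 h
      push_cast [Nat.cast_sub hN8] at h'
      refine le_trans ?_ h'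
      rw [zero_mul, add_zero, add_zero, add_zero]
      exact mul_le_mul (by linarith) hM (by positivity) (by linarith)
    · intro n hn
      refine (coe_fib_le_goldenRatio_pow n).trans
        ((pow_le_iff_le_log_div one_lt_goldenRatio (by linarith) n).2 ?_)
      exact (Nat.le_floor_iff (by positivity)).1 (Nat.lt_succ_iff.1 hn)
    · intro m hm
      refine (pow_le_iff_le_log_div one_lt_two (by linarith) m).2 ?_
      exact (Nat.le_floor_iff (by positivity)).1 (Nat.lt_succ_iff.1 hm)
  · filter_upwards [eventually_ge_atTop 1] with x hx
    have hL0 : 0 ≤ Real.log x := Real.log_nonneg hx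
    have hx0 : 0 < x := by linarith
    have hC0 : 0 < C := by linarith
    have hx24 : 0 < C * x ^ 24 := by positivity
    have hx24' : 1 ≤ C * x ^ 24 := one_le_mul_of_one_le_of_one_le hC (one_le_pow₀ hx)
    simp only [Function.comp_apply]
    refine div_le_div_of_nonneg_right ?_ (by positivity)
    have h := hupper x (⌊Real.log (100 * x) / Real.log φ⌋₊ + 1)
      (⌊Real.log (32 * x) / Real.log 2⌋₊ + 1) (⌊Real.log (C * x ^ 24) / Real.log 2⌋₊ + 1) hx
      (fun n hn => lt_floor_add_one_of_pow_le one_lt_goldenRatio (by linarith) (by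
        linarith [goldenRatio_pow_le_three_mul_fib_add_one n]))
      (fun m hm => lt_floor_add_one_of_pow_le one_lt_two (by linarith) hm)
      (fun m hm => lt_floor_add_one_of_pow_le one_lt_two hx24 hm.le)
    have h1 := Nat.floor_le (div_nonneg (Real.log_nonneg (by linarith : 1 ≤ 100 * x)) hα.le)
    have h2 := Nat.floor_le (div_nonneg (Real.log_nonneg (by linarith : 1 ≤ 32 * x)) hβ.le)
    have h3 := Nat.floor_le (div_nonneg (Real.log_nonneg hx24') hβ.le)
    generalize ⌊Real.log (100 * x) / Real.log φ⌋₊ = N at *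
    generalize ⌊Real.log (32 * x) / Real.log 2⌋₊ = M at *
    generalize ⌊Real.log (C * x ^ 24) / Real.log 2⌋₊ = K at *
    rw [Real.log_mul (by norm_num) hx0.ne', add_div] at h1 h2
    rw [Real.log_mul hC0.ne' (by positivity), Real.log_pow, add_div] at h3
    push_cast at h3
    refine (Nat.cast_le (α := ℝ).2 h).trans ?_
    push_cast
    have h4 : ((N : ℝ) + 1) * (M + 1) ≤
        (Real.log x / Real.log φ + (Real.log 100 / Real.log φ + 1)) *
        (Real.log x / Real.log 2 + (Real.log 32 / Real.log 2 + 1)) :=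
      mul_le_mul (by linarith) (by linarith) (by positivity)
        (by linarith [Nat.cast_nonneg (α := ℝ) N])
    have h5 : 24 / Real.log 2 * Real.log x = 24 * Real.log x / Real.log 2 := by ring
    linarith

theorem fibonacci_minus_powers_of_two_asymptotic
    (F : ℕ → ℤ) (hF0 : F 0 = 0) (hF1 : F 1 = 1)
    (hFrec : ∀ n : ℕ, F (n + 2) = F n + F (n + 1)) :
    Tendsto (fun x : ℝ =>
      (Nat.card {c : ℤ | (|c| : ℝ) ≤ x ∧ ∃ n m : ℕ, c = F n - 2 ^ m} : ℝ) /
        ((Real.log x) ^ 2 / (Real.log ((1 + Real.sqrt 5) / 2) * Real.log 2)))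
      atTop (nhds 1) := by
  have hF : ∀ n, F n = Nat.fib n ∧ F (n + 1) = Nat.fib (n + 1) := by
    intro n
    induction n with
    | zero => simp [hF0, hF1]
    | succ n ih =>
      refine ⟨ih.2, ?_⟩
      rw [hFrec, ih.1, ih.2, Nat.fib_add_two]
      push_cast
      ring
  simp only [fun n => (hF n).1]
  exact tendsto_card_fib_sub_two_pow
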